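/- arXiv:2308.16277 — 8 statements merged into one kernel-verified Lean document; each statement's English description precedes it below -/
import Mathlib

section
/- Let n ≥ 1 and let p and q be distinct prime divisors of n. Assume S ⊆ ℤ_n satisfies 0 ∈ S and S is not contained in any proper subgroup of ℤ_n. Then there exist s₁, s₂ ∈ S such that p ∤ (s₁ − s₂) and q ∤ (s₁ − s₂). -/
theorem exists_pair_not_dvd_aux (n : ℕ) (hn : 1 ≤ n) (p : ℕ) (hpn : p ∣ n) (x : ZMod n) :
    p ∣ x.val ↔ ZMod.castHom hpn (ZMod p) x = 0 := by
  haveI : NeZero n := ⟨by omega⟩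
  rw [← ZMod.natCast_eq_zero_iff, ZMod.castHom_apply, ZMod.natCast_val]

theorem exists_pair_not_dvd_aux2 (n p : ℕ) (hp : p.Prime) (hpn : p ∣ n)
    (S : Finset (ZMod n))
    (hsub : ∀ H : AddSubgroup (ZMod n), (∀ s ∈ S, s ∈ H) → H = ⊤) :
    ∃ s ∈ S, ZMod.castHom hpn (ZMod p) s ≠ 0 := by
  by_contra! h
  haveI : Fact p.Prime := ⟨hp⟩
  have h1 := hsub (ZMod.castHom hpn (ZMod p)).toAddMonoidHom.ker (fun s hs => h s hs)
  have h2 : (1 : ZMod n) ∈ (ZMod.castHom hpn (ZMod p)).toAddMonoidHom.ker := by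
    rw [h1]; trivial
  have h3 : ZMod.castHom hpn (ZMod p) 1 = 0 := h2
  rw [map_one] at h3
  exact one_ne_zero h3

theorem exists_pair_not_dvd
    (n : ℕ) (hn : 1 ≤ n) (p q : ℕ) (hp : p.Prime) (hq : q.Prime) (hpq : p ≠ q)
    (hpn : p ∣ n) (hqn : q ∣ n)
    (S : Finset (ZMod n)) (h0 : (0 : ZMod n) ∈ S)
    (hsub : ∀ H : AddSubgroup (ZMod n), (∀ s ∈ S, s ∈ H) → H = ⊤) :
    ∃ s₁ ∈ S, ∃ s₂ ∈ S, ¬ p ∣ (s₁ - s₂).val ∧ ¬ q ∣ (s₁ - s₂).val := by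
  obtain ⟨a, ha, hap⟩ := exists_pair_not_dvd_aux2 n p hp hpn S hsub
  obtain ⟨b, hb, hbq⟩ := exists_pair_not_dvd_aux2 n q hq hqn S hsub
  simp only [exists_pair_not_dvd_aux n hn p hpn, exists_pair_not_dvd_aux n hn q hqn, map_sub]
  by_cases haq : ZMod.castHom hqn (ZMod q) a = 0
  · by_cases hbp : ZMod.castHom hpn (ZMod p) b = 0
    · refine ⟨a, ha, b, hb, ?_, ?_⟩
      · rwa [hbp, sub_zero]
      · rwa [haq, zero_sub, neg_eq_zero]
    · refine ⟨b, hb, 0, h0, ?_, ?_⟩ <;> rwa [map_zero, sub_zero]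
  · refine ⟨a, ha, 0, h0, ?_, ?_⟩ <;> rwa [map_zero, sub_zero]
end

section
/- If (S, Λ) is a spectral pair in ℤ_n, then (Λ, S) is a spectral pair in ℤ_n. -/
/-- `(S, Λ)` is a spectral pair in `ℤ_n = ZMod n`. -/
def SpectralPair (n : ℕ) (S Λ : Finset (ZMod n)) : Prop :=
  Λ.card = S.card ∧
    ∀ lam ∈ Λ, ∀ mu ∈ Λ, lam ≠ mu →
      ∑ s ∈ S, Complex.exp (2 * Real.pi * Complex.I *
        (((lam - mu).val * s.val : ℕ) : ℂ) / (n : ℂ)) = 0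

theorem spectral_exp_eq (n : ℕ) [NeZero n] (a b : ZMod n) :
    Complex.exp (2 * Real.pi * Complex.I * ((a.val * b.val : ℕ) : ℂ) / (n : ℂ))
      = ZMod.stdAddChar (a * b) := by
  have h := ZMod.stdAddChar_coe (N := n) ((a.val * b.val : ℕ) : ℤ)
  push_cast at h
  rw [ZMod.natCast_zmod_val, ZMod.natCast_zmod_val] at h
  rw [h]
  push_cast
  rfl

theorem spectralPair_symm
    (n : ℕ) (hn : 1 ≤ n) (S Λ : Finset (ZMod n)) (h : SpectralPair n S Λ) :
    SpectralPair n Λ S := by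
  haveI : NeZero n := ⟨by omega⟩
  obtain ⟨hc, ho⟩ := h
  simp only [spectral_exp_eq] at ho
  refine ⟨hc.symm, ?_⟩
  intro t ht s hs hts
  simp only [spectral_exp_eq]
  have hS : (S.card : ℂ) ≠ 0 := by
    exact_mod_cast (Finset.card_pos.mpr ⟨t, ht⟩).ne'
  let A : Matrix Λ S ℂ := Matrix.of fun l s => ZMod.stdAddChar (l.1 * s.1)
  let B : Matrix S Λ ℂ := Matrix.of fun s l => (S.card : ℂ)⁻¹ * ZMod.stdAddChar (-(l.1 * s.1))
  have e : Λ ≃ S := Fintype.equivOfCardEq (by simpa using hc)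
  have hAB : A * B = 1 := by
    ext l m
    have key : (A * B) l m
        = (S.card : ℂ)⁻¹ * ∑ s ∈ S, ZMod.stdAddChar ((l.1 - m.1) * s) := by
      rw [Matrix.mul_apply, ← Finset.sum_coe_sort S, Finset.mul_sum]
      refine Finset.sum_congr rfl fun s _ => ?_
      simp only [A, B, Matrix.of_apply]
      rw [sub_mul, sub_eq_add_neg, AddChar.map_add_eq_mul]
      ring
    rw [key]
    by_cases hlm : l = m
    · subst hlm
      simp [hS]
    · rw [ho l.1 l.2 m.1 m.2 (fun h => hlm (Subtype.ext h)), Matrix.one_apply_ne hlm, mul_zero]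
  have hBA : B * A = 1 := (Matrix.mul_eq_one_comm_of_equiv e).mp hAB
  have hne : (⟨s, hs⟩ : S) ≠ ⟨t, ht⟩ := fun h => hts (congrArg Subtype.val h).symm
  have h0 : (B * A) ⟨s, hs⟩ ⟨t, ht⟩ = 0 := by rw [hBA, Matrix.one_apply_ne hne]
  have key : (B * A) ⟨s, hs⟩ ⟨t, ht⟩
      = (S.card : ℂ)⁻¹ * ∑ l ∈ Λ, ZMod.stdAddChar ((t - s) * l) := by
    rw [Matrix.mul_apply, ← Finset.sum_coe_sort Λ, Finset.mul_sum]
    refine Finset.sum_congr rfl fun l _ => ?_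
    simp only [A, B, Matrix.of_apply]
    rw [show (t - s) * l.1 = l.1 * t + -(l.1 * s) by ring, AddChar.map_add_eq_mul]
    ring
  rw [key] at h0
  exact (mul_eq_zero.mp h0).resolve_left (inv_ne_zero hS)
end

section
/- Let r be a prime divisor of n and let S be a subset of ℤ_n. Assume there is a divisor m of n with gcd(m, r) = 1 such that Φ_{mr} ∣ m_S but Φ_m ∤ m_S. Then |S| ≥ r, and moreover every coset of the subgroup of ℤ_n of order n/r (equivalently, of index r) contains at least one point of S. -/
open Polynomial

/-- The mask polynomial of a subset `S` of `ZMod n`. -/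
noncomputable def maskPoly (n : ℕ) (S : Finset (ZMod n)) : Polynomial ℤ :=
  ∑ s ∈ S, Polynomial.X ^ s.val

theorem laba_marshall_key
    (n r : ℕ) (hn : 1 ≤ n) (hr : r.Prime)
    (S : Finset (ZMod n))
    (m : ℕ) (hm : m ∣ n) (hmr : Nat.gcd m r = 1)
    (hdvd : cyclotomic (m * r) ℤ ∣ maskPoly n S)
    (hndvd : ¬ cyclotomic m ℤ ∣ maskPoly n S) (k : ℕ) :
    ∃ s ∈ S, s.val ≡ k [MOD r] := by
  by_contra! hcon
  apply hndvd
  have hm0 : m ≠ 0 := by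
    rintro rfl
    rw [zero_dvd_iff] at hm
    omega
  have hr0 : r ≠ 0 := hr.ne_zero
  have hζ := Complex.isPrimitiveRoot_exp m hm0
  have hω := Complex.isPrimitiveRoot_exp r hr0
  generalize Complex.exp (2 * Real.pi * Complex.I / m) = ζ at hζ
  generalize Complex.exp (2 * Real.pi * Complex.I / r) = ω at hω
  have hev : ∀ z : ℂ, aeval z (maskPoly n S) = ∑ s ∈ S, z ^ s.val := by
    intro z
    simp [maskPoly, map_sum]
  have hzero : ∀ j ∈ Finset.range r, j ≠ 0 → aeval (ζ * ω ^ j) (maskPoly n S) = 0 := by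
    intro j hj hj0
    rw [Finset.mem_range] at hj
    have hcop : Nat.Coprime j r :=
      ((Nat.Prime.coprime_iff_not_dvd hr).2 (Nat.not_dvd_of_pos_of_lt (Nat.pos_of_ne_zero hj0) hj)).symm
    have h1 : IsPrimitiveRoot (ω ^ j) r := hω.pow_of_coprime j hcop
    have h2 : IsPrimitiveRoot (ζ * ω ^ j) (m * r) := by
      have := IsPrimitiveRoot.orderOf (ζ * ω ^ j)
      rwa [(Commute.all ζ (ω ^ j)).orderOf_mul_eq_mul_orderOf_of_coprime
        (by rw [← hζ.eq_orderOf, ← h1.eq_orderOf]; exact hmr),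
        ← hζ.eq_orderOf, ← h1.eq_orderOf] at this
    obtain ⟨q, hq⟩ := hdvd
    rw [hq, map_mul]
    have h3 : aeval (ζ * ω ^ j) (cyclotomic (m * r) ℤ) = 0 := by
      rw [cyclotomic_eq_minpoly h2 (by positivity)]
      exact minpoly.aeval _ _
    rw [h3, zero_mul]
  have hsum : ∑ j ∈ Finset.range r,
      ω ^ (j * ((r - 1) * k)) * aeval (ζ * ω ^ j) (maskPoly n S) = 0 := by
    simp_rw [hev, Finset.mul_sum]
    rw [Finset.sum_comm]
    apply Finset.sum_eq_zero
    intro s hs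
    have hne : ω ^ (s.val + (r - 1) * k) ≠ 1 := by
      intro h
      have hd := (hω.pow_eq_one_iff_dvd _).1 h
      apply hcon s hs
      have e : s.val + (r - 1) * k + k = s.val + r * k := by
        obtain ⟨t, rfl⟩ := Nat.exists_eq_succ_of_ne_zero hr0
        simp
        ring
      have h4 : s.val + (r - 1) * k + k ≡ 0 + k [MOD r] :=
        Nat.ModEq.add_right k ((Nat.modEq_zero_iff_dvd).2 hd)
      rw [e, zero_add] at h4
      have h5 : s.val + r * k ≡ s.val [MOD r] := by
        simp [Nat.ModEq]
      exact h5.symm.trans h4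
    have hg := mul_geom_sum (ω ^ (s.val + (r - 1) * k)) r
    have h6 : (ω ^ (s.val + (r - 1) * k)) ^ r = 1 := by
      rw [← pow_mul, mul_comm, pow_mul, hω.pow_eq_one, one_pow]
    rw [h6, sub_self] at hg
    have h7 := (mul_eq_zero.1 hg).resolve_left (sub_ne_zero.2 hne)
    calc _ = ∑ j ∈ Finset.range r, ζ ^ s.val * (ω ^ (s.val + (r - 1) * k)) ^ j := by
          apply Finset.sum_congr rfl
          intro j _
          rw [mul_pow, ← pow_mul, ← pow_mul]
          rw [add_mul, pow_add, mul_comm j, mul_comm j]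
          ring
      _ = 0 := by rw [← Finset.mul_sum, h7, mul_zero]
  rw [Finset.sum_eq_single_of_mem 0 (Finset.mem_range.2 hr.pos)
    (fun j hj hj0 => by rw [hzero j hj hj0, mul_zero])] at hsum
  simp only [zero_mul, pow_zero, one_mul, mul_one] at hsum
  rw [cyclotomic_eq_minpoly hζ (Nat.pos_of_ne_zero hm0)]
  exact minpoly.isIntegrallyClosed_dvd (hζ.isIntegral (Nat.pos_of_ne_zero hm0)) hsum

theorem laba_marshall
    (n r : ℕ) (hn : 1 ≤ n) (hr : r.Prime) (hrn : r ∣ n)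
    (S : Finset (ZMod n))
    (m : ℕ) (hm : m ∣ n) (hmr : Nat.gcd m r = 1)
    (hdvd : cyclotomic (m * r) ℤ ∣ maskPoly n S)
    (hndvd : ¬ cyclotomic m ℤ ∣ maskPoly n S) :
    r ≤ S.card ∧
      ∀ H : AddSubgroup (ZMod n), Nat.card H = n / r →
        ∀ x : ZMod n, ∃ s ∈ S, s - x ∈ H := by
  have key := laba_marshall_key n r hn hr S m hm hmr hdvd hndvd
  have : NeZero n := ⟨by omega⟩
  constructor
  · have h : Set.SurjOn (fun s : ZMod n => s.val % r) S (Finset.range r) := by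
      intro k hk
      obtain ⟨s, hs, hsk⟩ := key k
      refine ⟨s, hs, ?_⟩
      have hk' : k < r := by simpa using hk
      exact Eq.trans hsk (Nat.mod_eq_of_lt hk')
    simpa using Finset.card_le_card_of_surjOn _ h
  · intro H hH x
    obtain ⟨s, hs, hsx⟩ := key x.val
    refine ⟨s, hs, ?_⟩
    have hidx : H.index = r := by
      have h1 := H.card_mul_index
      rw [hH, Nat.card_zmod] at h1
      obtain ⟨t, rfl⟩ := hrn
      rw [Nat.mul_div_cancel_left _ hr.pos] at h1
      have ht : 0 < t := Nat.pos_of_ne_zero (by rintro rfl; simp at hn)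
      exact Nat.eq_of_mul_eq_mul_left ht (h1.trans (mul_comm r t))
    obtain ⟨c, hc⟩ := (Nat.modEq_iff_dvd.1 hsx.symm)
    have h2 : s - x = r • (c : ZMod n) := by
      have := congrArg (Int.cast : ℤ → ZMod n) hc
      push_cast at this
      simpa using this
    rw [h2, ← hidx]
    exact H.nsmul_index_mem _
end

section
/- Let p, q, r be distinct primes with p^2 * q^2 < r, and let (S, Λ) be a spectral pair in ℤ_{p^2 q^2 r} with |S| > p^2 * q^2. Then Φ_r ∣ m_S, Φ_r ∣ m_Λ, and r divides |S|. -/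
open Polynomial

lemma term_eq_aux (n : ℕ) [NeZero n] (x s : ZMod n) :
    Complex.exp (2 * Real.pi * Complex.I * ((x.val * s.val : ℕ) : ℂ) / (n : ℂ))
      = ZMod.stdAddChar (x * s) := by
  have h := ZMod.stdAddChar_coe (N := n) ((x.val * s.val : ℕ) : ℤ)
  rw [← Int.cast_natCast (R := ℂ), ← h]
  congr 1
  push_cast
  simp

lemma SpectralPair.symm_aux {n : ℕ} [NeZero n] {S T : Finset (ZMod n)}
    (h : SpectralPair n S T) : SpectralPair n T S := by
  obtain ⟨hc, h⟩ := h
  refine ⟨hc.symm, ?_⟩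
  intro a ha b hb hab
  simp only [term_eq_aux] at h ⊢
  have hS : (S.card : ℂ) ≠ 0 := by
    have := Finset.card_pos.mpr ⟨a, ha⟩
    exact_mod_cast this.ne'
  let M : Matrix T S ℂ := fun x s => ZMod.stdAddChar (x.1 * s.1)
  let N : Matrix S T ℂ := fun s x => (S.card : ℂ)⁻¹ * ZMod.stdAddChar (-(x.1 * s.1))
  have hMN : M * N = 1 := by
    ext x y
    have e : (M * N) x y = (S.card : ℂ)⁻¹ *
        ∑ s ∈ S, (ZMod.stdAddChar ((x.1 - y.1) * s) : ℂ) := by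
      rw [Matrix.mul_apply, Finset.mul_sum, ← Finset.sum_coe_sort S]
      refine Finset.sum_congr rfl fun s _ => ?_
      simp only [M, N]
      rw [sub_mul, sub_eq_add_neg, AddChar.map_add_eq_mul]
      ring
    rw [e, Matrix.one_apply]
    split_ifs with hxy
    · subst hxy
      simp [hS]
    · rw [h x.1 x.2 y.1 y.2 (fun h => hxy (Subtype.ext h)), mul_zero]
  have hcard : Fintype.card T = Fintype.card S := by simpa using hc
  have hNM : N * M = 1 := (Matrix.mul_eq_one_comm_of_card_eq _ _ _ hcard).mp hMN
  have e : (N * M) ⟨b, hb⟩ ⟨a, ha⟩ = (S.card : ℂ)⁻¹ *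
      ∑ s ∈ T, (ZMod.stdAddChar ((a - b) * s) : ℂ) := by
    rw [Matrix.mul_apply, Finset.mul_sum, ← Finset.sum_coe_sort T]
    refine Finset.sum_congr rfl fun s _ => ?_
    simp only [M, N]
    rw [show (a - b) * s.1 = -(s.1 * b) + s.1 * a by ring, AddChar.map_add_eq_mul]
    ring
  rw [hNM, Matrix.one_apply_ne (by simpa using hab.symm)] at e
  have := mul_eq_zero.mp e.symm
  simpa [hS] using this

lemma phi_dvd_aux (m r : ℕ) (hm : 0 < m) (hr : r.Prime) (S T : Finset (ZMod (m * r)))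
    (h : SpectralPair (m * r) S T) (hcard : m < T.card) :
    cyclotomic r ℤ ∣ maskPoly (m * r) S := by
  obtain ⟨-, h⟩ := h
  have : NeZero m := ⟨hm.ne'⟩
  have : NeZero r := ⟨hr.ne_zero⟩
  have : NeZero (m * r) := ⟨mul_ne_zero hm.ne' hr.ne_zero⟩
  obtain ⟨a, ha, b, hb, hab, hf⟩ := Finset.exists_ne_map_eq_of_card_lt_of_maps_to
    (s := T) (t := (Finset.univ : Finset (ZMod m))) (by simpa using hcard)
    (f := ZMod.castHom (Dvd.intro r rfl) (ZMod m)) (fun _ _ => by simp)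
  have h1 := h a ha b hb hab
  have h0 : ZMod.castHom (Dvd.intro r rfl) (ZMod m) (a - b) = 0 := by
    rw [map_sub, hf, sub_self]
  have hdv : m ∣ (a - b).val := by
    rw [← ZMod.natCast_eq_zero_iff, ← h0, ZMod.castHom_apply, ZMod.cast_eq_val]
  obtain ⟨k, hk⟩ := hdv
  have hkr : k < r := by
    have := ZMod.val_lt (a - b)
    rw [hk] at this
    exact lt_of_mul_lt_mul_left this (Nat.zero_le m)
  have hk0 : k ≠ 0 := by
    rintro rfl
    rw [mul_zero, ZMod.val_eq_zero] at hk
    exact hab (sub_eq_zero.mp hk)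
  have hcop : k.Coprime r := ((Nat.Prime.coprime_iff_not_dvd hr).mpr (Nat.not_dvd_of_pos_of_lt (Nat.pos_of_ne_zero hk0) hkr)).symm
  have hprim := Complex.isPrimitiveRoot_exp_of_coprime k r hr.ne_zero hcop
  rw [cyclotomic_eq_minpoly hprim hr.pos]
  refine minpoly.isIntegrallyClosed_dvd (hprim.isIntegral hr.pos) ?_
  rw [maskPoly, map_sum, ← h1]
  refine Finset.sum_congr rfl fun s _ => ?_
  rw [map_pow, aeval_X, ← Complex.exp_nat_mul, hk]
  congr 1
  have : (m : ℂ) ≠ 0 := by exact_mod_cast hm.ne'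
  have : (r : ℂ) ≠ 0 := by exact_mod_cast hr.ne_zero
  push_cast
  field_simp

theorem phi_r_dvd_mask
    (p q r : ℕ) (hp : p.Prime) (hq : q.Prime) (hr : r.Prime)
    (hpq : p ≠ q) (hpr : p ≠ r) (hqr : q ≠ r)
    (hlt : p ^ 2 * q ^ 2 < r)
    (S Λ : Finset (ZMod (p ^ 2 * q ^ 2 * r)))
    (h : SpectralPair (p ^ 2 * q ^ 2 * r) S Λ)
    (hcard : p ^ 2 * q ^ 2 < S.card) :
    cyclotomic r ℤ ∣ maskPoly (p ^ 2 * q ^ 2 * r) S ∧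
    cyclotomic r ℤ ∣ maskPoly (p ^ 2 * q ^ 2 * r) Λ ∧
    r ∣ S.card := by
  have hm : 0 < p ^ 2 * q ^ 2 := Nat.mul_pos (pow_pos hp.pos 2) (pow_pos hq.pos 2)
  have : NeZero (p ^ 2 * q ^ 2 * r) := ⟨mul_ne_zero hm.ne' hr.ne_zero⟩
  have h1 := phi_dvd_aux _ r hm hr S Λ h (by rw [h.1]; exact hcard)
  refine ⟨h1, phi_dvd_aux _ r hm hr Λ S h.symm_aux hcard, ?_⟩
  have : Fact r.Prime := ⟨hr⟩
  have h2 := eval_dvd (x := (1 : ℤ)) h1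
  rw [eval_one_cyclotomic_prime, maskPoly, eval_finsetSum] at h2
  simp only [eval_pow, eval_X, one_pow, Finset.sum_const, nsmul_eq_mul, mul_one] at h2
  exact_mod_cast h2
end

section
/- Let p, q, r be distinct primes with p^2 * q^2 ≤ r, and let (S, Λ) be a spectral pair in ℤ_{p^2 q^2 r}. Then either S tiles ℤ_{p^2 q^2 r}, or all of the following hold: Φ_r ∣ m_S, Φ_r ∣ m_Λ, and r divides |S|. -/
open Polynomial

/-- `S` tiles `ZMod n`. -/
def IsTile (n : ℕ) (S : Finset (ZMod n)) : Prop :=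
  ∃ T : Finset (ZMod n), ∀ g : ZMod n,
    ∃! st : ZMod n × ZMod n, st.1 ∈ S ∧ st.2 ∈ T ∧ st.1 + st.2 = g

namespace TileAux

/-- mask polynomial of a finite set of naturals -/
noncomputable def F (S : Finset ℕ) : ℤ[X] := ∑ s ∈ S, X ^ s

/-- `Φ_d` divides the mask polynomial -/
def Z (S : Finset ℕ) (d : ℕ) : Prop := cyclotomic d ℤ ∣ F S

/-- the order of `a - b` in `ℤ/N` -/
def od (N a b : ℕ) : ℕ := N / Int.gcd (N : ℤ) ((a : ℤ) - b)

structure Spec (N : ℕ) (S L : Finset ℕ) : Prop where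
  card : L.card = S.card
  orth : ∀ a ∈ L, ∀ b ∈ L, a ≠ b → Z S (od N a b)

def Direct (N : ℕ) (S T : Finset ℕ) : Prop :=
  ∀ s ∈ S, ∀ s' ∈ S, ∀ t ∈ T, ∀ t' ∈ T, s + t ≡ s' + t' [MOD N] → s = s' ∧ t = t'

def Tile (N : ℕ) (S : Finset ℕ) : Prop :=
  ∃ T : Finset ℕ, S.card * T.card = N ∧ Direct N S T

lemma od_pos {N a b : ℕ} (hN : 0 < N) : 0 < od N a b := by
  have h : Int.gcd (N : ℤ) ((a : ℤ) - b) ∣ N := by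
    exact_mod_cast Int.gcd_dvd_left (N : ℤ) ((a : ℤ) - b)
  exact Nat.div_pos (Nat.le_of_dvd hN h) (Nat.pos_of_dvd_of_pos h hN)

lemma od_mul (N a b : ℕ) : od N a b * Int.gcd (N : ℤ) ((a : ℤ) - b) = N := by
  have h : Int.gcd (N : ℤ) ((a : ℤ) - b) ∣ N := by
    exact_mod_cast Int.gcd_dvd_left (N : ℤ) ((a : ℤ) - b)
  exact Nat.div_mul_cancel h

lemma od_dvd (N a b : ℕ) : od N a b ∣ N := ⟨_, (od_mul N a b).symm⟩

lemma od_dvd_iff {N a b e f : ℕ} (hN : 0 < N) (h : N = e * f) :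
    od N a b ∣ e ↔ a ≡ b [MOD f] := by
  have he : 0 < e := Nat.pos_of_ne_zero (by rintro rfl; simp at h; omega)
  have hm := od_mul N a b
  have ho := od_pos (a := a) (b := b) hN
  set g := Int.gcd (N : ℤ) ((a : ℤ) - b) with hg
  have h1 : od N a b ∣ e ↔ f ∣ g := by
    constructor
    · rintro ⟨c, hc⟩
      refine ⟨c, ?_⟩
      have : od N a b * g = od N a b * (f * c) := by
        rw [hm]; conv_lhs => rw [h, hc]
        ring
      exact Nat.eq_of_mul_eq_mul_left ho this
    · rintro ⟨c, hc⟩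
      refine ⟨c, ?_⟩
      have hf : 0 < f := Nat.pos_of_ne_zero (by rintro rfl; simp at h; omega)
      have : f * e = f * (od N a b * c) := by
        rw [mul_comm f e, ← h]; conv_lhs => rw [← hm, hc]
        ring
      exact Nat.eq_of_mul_eq_mul_left hf this
  rw [h1, hg, Int.dvd_gcd_iff, Nat.ModEq.comm, Nat.modEq_iff_dvd]
  constructor
  · rintro ⟨_, h⟩; exact_mod_cast h
  · intro h'; exact ⟨by exact_mod_cast (Dvd.intro_left e h.symm), h'⟩

lemma od_comm (N a b : ℕ) : od N a b = od N b a := by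
  unfold od
  rw [← neg_sub (b : ℤ) a, Int.gcd_neg]

lemma Z_iff {S : Finset ℕ} {d : ℕ} (hd : 0 < d) {ζ : ℂ} (hζ : IsPrimitiveRoot ζ d) :
    Z S d ↔ ∑ s ∈ S, ζ ^ s = 0 := by
  have e : aeval ζ (F S) = ∑ s ∈ S, ζ ^ s := by simp [F]
  rw [← e, Z, cyclotomic_eq_minpoly hζ hd]
  exact (minpoly.isIntegrallyClosed_dvd_iff (hζ.isIntegral hd) _).symm

lemma Z_one {S : Finset ℕ} (h : Z S 1) : S = ∅ := by
  rw [Z_iff one_pos IsPrimitiveRoot.one] at h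
  simpa using h

lemma prim_od {N a b : ℕ} (hN : 0 < N) {ζ : ℂ} (hζ : IsPrimitiveRoot ζ N) :
    IsPrimitiveRoot (ζ ^ a * (ζ ^ b)⁻¹) (od N a b) := by
  have h0 : ζ ≠ 0 := hζ.ne_zero hN.ne'
  have e : ζ ^ a * (ζ ^ b)⁻¹ = ζ ^ ((a : ℤ) - b) := by
    rw [zpow_sub₀ h0]; simp [div_eq_mul_inv]
  rw [e]
  have key : ∀ l : ℕ, (ζ ^ ((a : ℤ) - b)) ^ l = 1 ↔ od N a b ∣ l := by
    intro l
    rw [← zpow_natCast, ← zpow_mul, hζ.zpow_eq_one_iff_dvd]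
    have hm := od_mul N a b
    set g := Int.gcd (N : ℤ) ((a : ℤ) - b) with hg
    have hgp : 0 < g := Nat.pos_of_ne_zero (by intro h; rw [h] at hm; simp at hm; omega)
    obtain ⟨D, hD⟩ : (g : ℤ) ∣ (a : ℤ) - b := Int.gcd_dvd_right _ _
    have hcop : IsCoprime ((od N a b : ℕ) : ℤ) D := by
      rw [Int.isCoprime_iff_gcd_eq_one]
      have : g * Int.gcd (od N a b : ℤ) D = g * 1 := by
        conv_rhs => rw [hg, hD, ← hm]
        push_cast
        rw [mul_comm ((od N a b : ℕ) : ℤ) (g : ℤ), Int.gcd_mul_left]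
        simp
      exact Nat.eq_of_mul_eq_mul_left hgp this
    have hgz : (g : ℤ) ≠ 0 := by exact_mod_cast hgp.ne'
    rw [hD]
    conv_lhs => rw [← hm]
    push_cast
    rw [mul_comm ((od N a b : ℕ) : ℤ) (g : ℤ), mul_assoc, mul_dvd_mul_iff_left hgz]
    rw [← Int.natCast_dvd_natCast]
    exact ⟨fun hh => hcop.dvd_of_dvd_mul_left hh, fun hh => Dvd.dvd.mul_left hh _⟩
  exact ⟨(key _).2 dvd_rfl, fun l hl => (key l).1 hl⟩

lemma Spec.symm {N : ℕ} {S L : Finset ℕ} (hN : 0 < N) (h : Spec N S L) : Spec N L S := by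
  classical
  refine ⟨h.card.symm, ?_⟩
  intro s hs s' hs' hne
  have hζ := Complex.isPrimitiveRoot_exp N hN.ne'
  set ζ := Complex.exp (2 * Real.pi * Complex.I / N) with hzdef
  have h0 : ζ ≠ 0 := hζ.ne_zero hN.ne'
  rw [Z_iff (od_pos hN) (prim_od hN hζ)]
  -- matrices
  let e : L ≃ S := Finset.equivOfCardEq h.card
  let A : Matrix L L ℂ := fun a b => (ζ ^ (a : ℕ)) ^ (e b : ℕ)
  let B : Matrix L L ℂ := fun b a => ((ζ ^ (a : ℕ))⁻¹) ^ (e b : ℕ)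
  have hk : (S.card : ℂ) ≠ 0 := by
    have := Finset.card_pos.2 ⟨s, hs⟩
    exact_mod_cast this.ne'
  have hAB : A * B = (S.card : ℂ) • (1 : Matrix L L ℂ) := by
    ext a b
    have e1 : (A * B) a b = ∑ x ∈ S, (ζ ^ (a : ℕ) * (ζ ^ (b : ℕ))⁻¹) ^ x := by
      rw [Matrix.mul_apply, ← Finset.sum_coe_sort S, ← e.sum_comp]
      refine Finset.sum_congr rfl fun x _ => ?_
      simp only [A, B, mul_pow]
    rw [e1]
    by_cases hab : a = b
    · subst hab
      simp [mul_inv_cancel₀ (pow_ne_zero _ h0)]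
    · have := h.orth a a.2 b b.2 (fun h => hab (Subtype.ext h))
      rw [Z_iff (od_pos hN) (prim_od hN hζ)] at this
      rw [this]; simp [hab]
  have hAB' : A * ((S.card : ℂ)⁻¹ • B) = 1 := by
    rw [Matrix.mul_smul, hAB, smul_smul, inv_mul_cancel₀ hk, one_smul]
  have hBA := mul_eq_one_comm.1 hAB'
  have := congrFun (congrFun hBA (e.symm ⟨s', hs'⟩)) (e.symm ⟨s, hs⟩)
  have hne' : e.symm ⟨s', hs'⟩ ≠ e.symm ⟨s, hs⟩ := by
    intro hh; apply hne; have := e.symm.injective hh; simpa using (congrArg Subtype.val this).symm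
  rw [Matrix.one_apply_ne hne', Matrix.smul_mul, Matrix.smul_apply, smul_eq_mul, mul_eq_zero] at this
  have := this.resolve_left (inv_ne_zero hk)
  rw [Matrix.mul_apply] at this
  rw [← Finset.sum_coe_sort L, ← this]
  refine Finset.sum_congr rfl fun x _ => ?_
  simp only [A, B, Equiv.apply_symm_apply, mul_pow, inv_pow, ← pow_mul]
  rw [mul_comm, mul_comm s, mul_comm s']

lemma Spec.inj {N : ℕ} {S L : Finset ℕ} (hN : 0 < N) (h : Spec N S L) :
    ∀ a ∈ L, ∀ b ∈ L, a ≡ b [MOD N] → a = b := by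
  intro a ha b hb hab
  by_contra hne
  have h1 : od N a b ∣ 1 := (od_dvd_iff hN (by simp)).2 hab
  have h2 := h.orth a ha b hb hne
  rw [Nat.dvd_one.1 h1] at h2
  have := Z_one h2
  have h3 := h.card
  rw [this] at h3
  simp at h3
  simp [h3] at ha


/-- number of elements of `S` congruent to `x` mod `N` -/
def cnt (S : Finset ℕ) (N x : ℕ) : ℕ := (S.filter (fun s => s ≡ x [MOD N])).card

lemma count_fourier {N : ℕ} (hN : 0 < N) {ζ : ℂ} (hζ : IsPrimitiveRoot ζ N)
    (w : ℕ → ℂ) (S : Finset ℕ) (x : ℕ) :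
    ∑ t ∈ Finset.range N, (∑ s ∈ S, w s * (ζ ^ t) ^ s) * (ζ⁻¹) ^ (t * x) =
      N * ∑ s ∈ S.filter (fun s => s ≡ x [MOD N]), w s := by
  have h0 : ζ ≠ 0 := hζ.ne_zero hN.ne'
  simp_rw [Finset.sum_mul]
  rw [Finset.sum_comm, Finset.mul_sum, Finset.sum_filter]
  refine Finset.sum_congr rfl fun s _ => ?_
  have e : ∀ t, w s * (ζ ^ t) ^ s * ζ⁻¹ ^ (t * x) = w s * (ζ ^ s * (ζ ^ x)⁻¹) ^ t := by
    intro t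
    rw [mul_assoc, mul_pow, inv_pow, inv_pow, ← pow_mul, ← pow_mul, ← pow_mul, mul_comm t, mul_comm t]
  simp_rw [e, ← Finset.mul_sum]
  have hp := prim_od (a := s) (b := x) hN hζ
  have h1 : od N s x ∣ 1 ↔ s ≡ x [MOD N] := od_dvd_iff hN (by simp)
  rw [Nat.dvd_one] at h1
  split_ifs with h
  · rw [h1.2 h, IsPrimitiveRoot.one_right_iff] at hp
    rw [hp]; simp [mul_comm]
  · have hne : ζ ^ s * (ζ ^ x)⁻¹ ≠ 1 := by
      intro hh; rw [hh] at hp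
      exact h (h1.1 (hp.unique IsPrimitiveRoot.one))
    rw [geom_sum_eq hne, (hp.pow_eq_one_iff_dvd N).2 (od_dvd _ _ _)]
    simp

lemma count_fourier' {N : ℕ} (hN : 0 < N) {ζ : ℂ} (hζ : IsPrimitiveRoot ζ N)
    (S : Finset ℕ) (x : ℕ) :
    ∑ t ∈ Finset.range N, (∑ s ∈ S, (ζ ^ t) ^ s) * (ζ⁻¹) ^ (t * x) = N * (cnt S N x : ℂ) := by
  have := count_fourier hN hζ (fun _ => 1) S x
  simpa [cnt] using this

lemma equidist {p : ℕ} (hp : p.Prime) {S : Finset ℕ} (h : Z S p) (c : ℕ) :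
    p * cnt S p c = S.card := by
  have hζ := Complex.isPrimitiveRoot_exp p hp.ne_zero
  set ζ := Complex.exp (2 * Real.pi * Complex.I / p)
  have := count_fourier' hp.pos hζ S c
  rw [Finset.sum_eq_single 0] at this
  · simp at this
    exact_mod_cast this.symm
  · intro t ht ht0
    have hc : t.Coprime p :=
      (Nat.coprime_of_lt_prime ht0 (Finset.mem_range.1 ht) hp).symm
    have := (Z_iff hp.pos (hζ.pow_of_coprime t hc)).1 h
    rw [this, zero_mul]
  · intro h; simp at h; exact absurd h hp.ne_zero

lemma drop_r {r d : ℕ} (hr : r.Prime) (hd : 0 < d) (hc : d.Coprime r) {S : Finset ℕ}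
    (hS : S.card < r) (h : Z S (d * r)) : Z S d := by
  have hω := Complex.isPrimitiveRoot_exp r hr.ne_zero
  set ω := Complex.exp (2 * Real.pi * Complex.I / r)
  have hζ := Complex.isPrimitiveRoot_exp d hd.ne'
  set ζ := Complex.exp (2 * Real.pi * Complex.I / d)
  rw [Z_iff hd hζ]
  -- a missing class
  obtain ⟨c, hcr, hcS⟩ : ∃ c ∈ Finset.range r, c ∉ S.image (· % r) := by
    by_contra hcon
    push Not at hcon
    have h1 := Finset.card_le_card (show Finset.range r ⊆ _ from hcon)
    have h2 := Finset.card_image_le (s := S) (f := (· % r))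
    simp at h1; omega
  have := count_fourier hr.pos hω (fun s => ζ ^ s) S c
  rw [Finset.sum_eq_single 0] at this
  · have he : S.filter (fun s => s ≡ c [MOD r]) = ∅ := by
      rw [Finset.filter_eq_empty_iff]
      intro s hs hh
      apply hcS
      rw [Finset.mem_image]
      exact ⟨s, hs, by rw [hh, Nat.mod_eq_of_lt (Finset.mem_range.1 hcr)]⟩
    rw [he] at this
    simpa using this
  · intro t ht ht0
    have hc' : t.Coprime r :=
      (Nat.coprime_of_lt_prime ht0 (Finset.mem_range.1 ht) hr).symm
    have hpr : IsPrimitiveRoot (ζ * ω ^ t) (d * r) := by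
      have h2 := hω.pow_of_coprime t hc'
      rw [IsPrimitiveRoot.iff_orderOf] at *
      rw [(Commute.all _ _).orderOf_mul_eq_mul_orderOf_of_coprime]
      · rw [h2, hζ]
      · rw [h2, hζ]; exact hc
    have := (Z_iff (Nat.mul_pos hd hr.pos) hpr).1 h
    simp_rw [mul_pow] at this
    simp_rw [this, zero_mul]
  · intro h; simp at h; exact absurd h hr.ne_zero

lemma rect {N p q u v : ℕ} (hN : 0 < N) (hu : N = p * u) (hv : N = q * v)
    (hpq : ∀ t, ¬ t.Coprime N → p ∣ t ∨ q ∣ t) {S : Finset ℕ} (h : Z S N) (x i j : ℕ) :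
    cnt S N (x + i * u + j * v) + cnt S N x = cnt S N (x + i * u) + cnt S N (x + j * v) := by
  have hζ := Complex.isPrimitiveRoot_exp N hN.ne'
  set ζ := Complex.exp (2 * Real.pi * Complex.I / N)
  have hN' : (N : ℂ) ≠ 0 := by exact_mod_cast hN.ne'
  suffices hh : (N : ℂ) * cnt S N (x + i * u + j * v) + N * cnt S N x
      - (N * cnt S N (x + i * u) + N * cnt S N (x + j * v)) = 0 by
    rw [← mul_add, ← mul_add, sub_eq_zero] at hh
    exact_mod_cast mul_left_cancel₀ hN' hh
  rw [← count_fourier' hN hζ, ← count_fourier' hN hζ, ← count_fourier' hN hζ,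
    ← count_fourier' hN hζ, ← Finset.sum_add_distrib, ← Finset.sum_add_distrib,
    ← Finset.sum_sub_distrib]
  refine Finset.sum_eq_zero fun t _ => ?_
  have hinv : ∀ m, N ∣ m → ζ⁻¹ ^ m = 1 := by
    intro m hm
    rw [inv_pow, (hζ.pow_eq_one_iff_dvd m).2 hm, inv_one]
  have e : ∀ g : ℂ, g * ζ⁻¹ ^ (t * (x + i * u + j * v)) + g * ζ⁻¹ ^ (t * x)
      - (g * ζ⁻¹ ^ (t * (x + i * u)) + g * ζ⁻¹ ^ (t * (x + j * v)))
      = g * ζ⁻¹ ^ (t * x) * ((1 - ζ⁻¹ ^ (t * (i * u))) * (1 - ζ⁻¹ ^ (t * (j * v)))) := by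
    intro g
    simp only [mul_add, pow_add]
    ring
  rw [e]
  by_cases hc : t.Coprime N
  · rw [(Z_iff hN (hζ.pow_of_coprime t hc)).1 h]; simp
  · rcases hpq t hc with ⟨c, hc⟩ | ⟨c, hc⟩
    · rw [hinv (t * (i * u)) ⟨c * i, by rw [hu, hc]; ring⟩]; simp
    · rw [hinv (t * (j * v)) ⟨c * j, by rw [hv, hc]; ring⟩]; simp

/-- `S` is (mod `N`) invariant under translation by `u` at `x`. -/
def PerAt (S : Finset ℕ) (N u x : ℕ) : Prop := ∀ i : ℕ, ∃ y ∈ S, y ≡ x + i * u [MOD N]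

lemma cnt_le_one {S : Finset ℕ} {N : ℕ} (hinj : ∀ a ∈ S, ∀ b ∈ S, a ≡ b [MOD N] → a = b)
    (x : ℕ) : cnt S N x ≤ 1 := by
  unfold cnt
  rw [Finset.card_le_one]
  intro a ha b hb
  simp only [Finset.mem_filter] at ha hb
  exact hinj a ha.1 b hb.1 (ha.2.trans hb.2.symm)

lemma cnt_pos_iff {S : Finset ℕ} {N x : ℕ} : 0 < cnt S N x ↔ ∃ y ∈ S, y ≡ x [MOD N] := by
  unfold cnt
  rw [Finset.card_pos]
  constructor
  · rintro ⟨y, hy⟩; rw [Finset.mem_filter] at hy; exact ⟨y, hy⟩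
  · rintro ⟨y, hy⟩; exact ⟨y, Finset.mem_filter.2 hy⟩

lemma lam_leung {N p q u v : ℕ} (hN : 0 < N) (hu : N = p * u) (hv : N = q * v)
    (hpq : ∀ t, ¬ t.Coprime N → p ∣ t ∨ q ∣ t) {S : Finset ℕ} (h : Z S N)
    {x : ℕ} (hx : x ∈ S) :
    PerAt S N u x ∨ PerAt S N v x := by
  by_contra hcon
  simp only [PerAt, not_or, not_forall] at hcon
  obtain ⟨⟨i, hi⟩, ⟨j, hj⟩⟩ := hcon
  rw [← cnt_pos_iff] at hi hj
  have := rect hN hu hv hpq h x i j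
  have hx' : 0 < cnt S N x := cnt_pos_iff.2 ⟨x, hx, rfl⟩
  omega

/-- if `z + Z_p` and `z + Z_q` are contained in `S` then the whole `z + Z_{pq}` is. -/
lemma full_rect {N p q u v : ℕ} (hN : 0 < N) (hu : N = p * u) (hv : N = q * v)
    (hpq : ∀ t, ¬ t.Coprime N → p ∣ t ∨ q ∣ t) {S : Finset ℕ} (h : Z S N)
    (hinj : ∀ a ∈ S, ∀ b ∈ S, a ≡ b [MOD N] → a = b) {z : ℕ}
    (h1 : PerAt S N u z) (h2 : PerAt S N v z) (i : ℕ) : PerAt S N v (z + i * u) := by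
  intro j
  rw [← cnt_pos_iff]
  have := rect hN hu hv hpq h z i j
  have a1 := cnt_pos_iff.2 (h1 i)
  have a2 := cnt_pos_iff.2 (h2 j)
  have a3 := cnt_le_one hinj z
  omega

lemma pow_of_modEq {ζ : ℂ} {d N a b : ℕ} (hζ : IsPrimitiveRoot ζ d) (hdN : d ∣ N)
    (hab : a ≡ b [MOD N]) : ζ ^ a = ζ ^ b := by
  have h : a ≡ b [MOD d] := hab.of_dvd hdN
  rw [pow_eq_pow_mod a hζ.pow_eq_one, h, ← pow_eq_pow_mod b hζ.pow_eq_one]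

/-- a finite union of `Z_p`-cosets kills `ζ` with `ζ ^ u ≠ 1`. -/
lemma periodic_Z {N u d : ℕ} (hd : 0 < d) (hdN : d ∣ N) (hdu : ¬ d ∣ u) {S : Finset ℕ}
    (hinj : ∀ a ∈ S, ∀ b ∈ S, a ≡ b [MOD N] → a = b)
    (hper : ∀ x ∈ S, PerAt S N u x) : Z S d := by
  have hζ := Complex.isPrimitiveRoot_exp d hd.ne'
  set ζ := Complex.exp (2 * Real.pi * Complex.I / d)
  rw [Z_iff hd hζ]
  have hper' : ∀ x ∈ S, ∃ y ∈ S, y ≡ x + u [MOD N] := fun x hx => by simpa using hper x hx 1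
  choose f hf hf' using hper'
  have hpow : ∀ a b, a ≡ b [MOD N] → ζ ^ a = ζ ^ b := by
    intro a b hab
    exact pow_of_modEq hζ hdN hab
  have hs : ∑ s ∈ S, ζ ^ (s + u) = ∑ s ∈ S, ζ ^ s := by
    have hfinj : ∀ a₁ (h₁ : a₁ ∈ S) a₂ (h₂ : a₂ ∈ S), f a₁ h₁ = f a₂ h₂ → a₁ = a₂ := by
      intro a ha b hb hab
      apply hinj a ha b hb
      have := (hf' a ha).symm.trans (hab ▸ hf' b hb)
      exact Nat.ModEq.add_right_cancel' u this
    refine Finset.sum_bij f (fun a ha => hf a ha) hfinj ?_ ?_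
    · intro b hb
      obtain ⟨a, ha, hh⟩ := Finset.surj_on_of_inj_on_of_card_le f (fun a ha => hf a ha)
        (fun _ _ h1 h2 => hfinj _ h1 _ h2) le_rfl b hb
      exact ⟨a, ha, hh.symm⟩
    · intro a ha
      exact (hpow _ _ (hf' a ha)).symm
  simp_rw [pow_add, ← Finset.sum_mul] at hs
  have hne : ζ ^ u ≠ 1 := fun hh => hdu ((hζ.pow_eq_one_iff_dvd u).1 hh)
  by_contra h0
  exact hne (mul_left_cancel₀ h0 (by rw [hs, mul_one]))

lemma Direct.image_eq {N : ℕ} (hN : 0 < N) {S T : Finset ℕ} (h : Direct N S T) :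
    Set.InjOn (fun st : ℕ × ℕ => (st.1 + st.2) % N) (S ×ˢ T : Finset (ℕ × ℕ)) ∧
    (S ×ˢ T).image (fun st : ℕ × ℕ => (st.1 + st.2) % N) ⊆ Finset.range N := by
  constructor
  · rintro ⟨s, t⟩ hst ⟨s', t'⟩ hst' he
    simp only [Finset.coe_product, Set.mem_prod, Finset.mem_coe] at hst hst'
    obtain ⟨h1, h2⟩ := h s hst.1 s' hst'.1 t hst.2 t' hst'.2 he
    simp [h1, h2]
  · intro x hx
    rw [Finset.mem_image] at hx
    obtain ⟨st, _, rfl⟩ := hx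
    exact Finset.mem_range.2 (Nat.mod_lt _ hN)

lemma Direct.card_le {N : ℕ} (hN : 0 < N) {S T : Finset ℕ} (h : Direct N S T) :
    S.card * T.card ≤ N := by
  obtain ⟨h1, h2⟩ := h.image_eq hN
  have := Finset.card_le_card h2
  rwa [Finset.card_image_of_injOn h1, Finset.card_product, Finset.card_range] at this

lemma Direct.sum_zero {N d : ℕ} (hN : 0 < N) {S T : Finset ℕ} (h : Direct N S T)
    (hc : S.card * T.card = N) (hd : d ∣ N) (hd1 : d ≠ 1) {ζ : ℂ} (hζ : IsPrimitiveRoot ζ d) :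
    (∑ s ∈ S, ζ ^ s) * (∑ t ∈ T, ζ ^ t) = 0 := by
  obtain ⟨h1, h2⟩ := h.image_eq hN
  have he : (S ×ˢ T).image (fun st : ℕ × ℕ => (st.1 + st.2) % N) = Finset.range N := by
    apply Finset.eq_of_subset_of_card_le h2
    rw [Finset.card_image_of_injOn h1, Finset.card_product, Finset.card_range, hc]
  have hne : ζ ≠ 1 := by
    rintro rfl
    exact hd1 (hζ.unique IsPrimitiveRoot.one)
  have hs : ∑ x ∈ Finset.range N, ζ ^ x = 0 := by
    rw [geom_sum_eq hne, (hζ.pow_eq_one_iff_dvd N).2 hd]; simp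
  rw [← he, Finset.sum_image h1] at hs
  rw [Finset.sum_mul_sum, ← Finset.sum_product', ← hs]
  refine Finset.sum_congr rfl fun st _ => ?_
  rw [← pow_add]
  exact pow_of_modEq hζ hd (Nat.mod_modEq _ _).symm

lemma tile_up {M N p : ℕ} (hN : 0 < N) (h : N = p * M) {S : Finset ℕ} (hS : S.Nonempty)
    (ht : Tile M S) : Tile N S := by
  obtain ⟨T, hc, hd⟩ := ht
  have hM : 0 < M := Nat.pos_of_ne_zero (by rintro rfl; simp at h; omega)
  obtain ⟨s0, hs0⟩ := hS
  have key : ∀ s ∈ S, ∀ s' ∈ S, ∀ t ∈ T, ∀ t' ∈ T, ∀ i < p, ∀ i' < p,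
      s + (t + M * i) ≡ s' + (t' + M * i') [MOD N] → s = s' ∧ t = t' ∧ i = i' := by
    intro s hs s' hs' t ht t' ht' i hi i' hi' he
    have h1 : s + t ≡ s' + t' [MOD M] := by
      have := he.of_dvd (show M ∣ N from ⟨p, by rw [h, mul_comm]⟩)
      rw [← add_assoc, ← add_assoc] at this
      simpa [Nat.ModEq] using this
    obtain ⟨rfl, rfl⟩ := hd s hs s' hs' t ht t' ht' h1
    refine ⟨rfl, rfl, ?_⟩
    have h2 := Nat.ModEq.add_left_cancel' t (Nat.ModEq.add_left_cancel' s he)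
    rw [h, mul_comm p M] at h2
    have h3 := Nat.ModEq.mul_left_cancel' hM.ne' h2
    exact h3.eq_of_lt_of_lt hi hi'
  refine ⟨(T ×ˢ Finset.range p).image (fun ti => ti.1 + M * ti.2), ?_, ?_⟩
  · rw [Finset.card_image_of_injOn, Finset.card_product, Finset.card_range, ← mul_assoc, hc, h,
      mul_comm]
    rintro ⟨t, i⟩ hti ⟨t', i'⟩ hti' he
    simp only [Finset.coe_product, Set.mem_prod, Finset.mem_coe, Finset.mem_range] at hti hti'
    have := key s0 hs0 s0 hs0 t hti.1 t' hti'.1 i hti.2 i' hti'.2 (by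
      simp only at he
      rw [he])
    simp [this.2.1, this.2.2]
  · intro s hs s' hs' t ht t' ht' he
    rw [Finset.mem_image] at ht ht'
    obtain ⟨⟨t, i⟩, hti, rfl⟩ := ht
    obtain ⟨⟨t', i'⟩, hti', rfl⟩ := ht'
    simp only [Finset.mem_product, Finset.mem_range] at hti hti'
    obtain ⟨a, b, c⟩ := key s hs s' hs' t hti.1 t' hti'.1 i hti.2 i' hti'.2 he
    exact ⟨a, by simp [b, c]⟩

lemma tile_up' {M N p : ℕ} (hN : 0 < N) (h : N = p * M) {S : Finset ℕ} (hS : S.Nonempty)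
    (hcong : ∀ a ∈ S, ∀ b ∈ S, a ≡ b [MOD p])
    (ht : Tile M (S.image (· / p))) : Tile N S := by
  obtain ⟨T, hc, hd⟩ := ht
  have hp : 0 < p := Nat.pos_of_ne_zero (by rintro rfl; simp at h; omega)
  obtain ⟨s0, hs0⟩ := hS
  have hdiv : ∀ a ∈ S, a = p * (a / p) + s0 % p := by
    intro a ha
    have h1 : a % p = s0 % p := hcong a ha s0 hs0
    rw [← h1]; exact (Nat.div_add_mod a p).symm
  have hinj : Set.InjOn (· / p) (S : Set ℕ) := by
    intro a ha b hb hab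
    simp only at hab
    rw [hdiv a ha, hdiv b hb, hab]
  rw [Finset.card_image_of_injOn hinj] at hc
  have key : ∀ s ∈ S, ∀ s' ∈ S, ∀ t ∈ T, ∀ t' ∈ T, ∀ i < p, ∀ i' < p,
      s + (p * t + i) ≡ s' + (p * t' + i') [MOD N] → s = s' ∧ t = t' ∧ i = i' := by
    intro s hs s' hs' t ht t' ht' i hi i' hi' he
    have h1 : i = i' := by
      have h2 := he.of_dvd (show p ∣ N from ⟨M, h⟩)
      have h3 := Nat.ModEq.add_left_cancel (hcong s hs s' hs') h2
      have h4 : p * t ≡ p * t' [MOD p] := by simp [Nat.ModEq]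
      exact (Nat.ModEq.add_left_cancel h4 h3).eq_of_lt_of_lt hi hi'
    subst h1
    rw [hdiv s hs, hdiv s' hs'] at he
    have h2 : p * (s / p + t) ≡ p * (s' / p + t') [MOD p * M] := by
      rw [← h]
      apply Nat.ModEq.add_right_cancel' (s0 % p + i)
      convert he using 1 <;> ring
    have h3 := Nat.ModEq.mul_left_cancel' hp.ne' h2
    obtain ⟨a, b⟩ := hd _ (Finset.mem_image_of_mem _ hs) _ (Finset.mem_image_of_mem _ hs') t ht t' ht' h3
    exact ⟨hinj hs hs' a, b, rfl⟩
  refine ⟨(T ×ˢ Finset.range p).image (fun ti => p * ti.1 + ti.2), ?_, ?_⟩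
  · rw [Finset.card_image_of_injOn, Finset.card_product, Finset.card_range, ← mul_assoc, hc, h,
      mul_comm]
    rintro ⟨t, i⟩ hti ⟨t', i'⟩ hti' he
    simp only [Finset.coe_product, Set.mem_prod, Finset.mem_coe, Finset.mem_range] at hti hti'
    have := key s0 hs0 s0 hs0 t hti.1 t' hti'.1 i hti.2 i' hti'.2 (by
      simp only at he
      rw [he])
    simp [this.2.1, this.2.2]
  · intro s hs s' hs' t ht t' ht' he
    rw [Finset.mem_image] at ht ht'
    obtain ⟨⟨t, i⟩, hti, rfl⟩ := ht
    obtain ⟨⟨t', i'⟩, hti', rfl⟩ := ht'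
    simp only [Finset.mem_product, Finset.mem_range] at hti hti'
    obtain ⟨a, b, c⟩ := key s hs s' hs' t hti.1 t' hti'.1 i hti.2 i' hti'.2 he
    exact ⟨a, by simp [b, c]⟩

lemma od_div {M p a b : ℕ} (hp : 0 < p) (hab : a ≡ b [MOD p]) :
    od M (a / p) (b / p) = od (p * M) a b := by
  have h1 : (a : ℤ) - b = p * (((a / p : ℕ) : ℤ) - ((b / p : ℕ) : ℤ)) := by
    have ha := Nat.div_add_mod a p
    have hb := Nat.div_add_mod b p
    have hab' : a % p = b % p := hab
    rw [hab'] at ha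
    have ha' : (p : ℤ) * ((a / p : ℕ) : ℤ) + ((b % p : ℕ) : ℤ) = a := by exact_mod_cast ha
    have hb' : (p : ℤ) * ((b / p : ℕ) : ℤ) + ((b % p : ℕ) : ℤ) = b := by exact_mod_cast hb
    rw [← ha', ← hb']; ring
  unfold od
  rw [h1]
  push_cast [Int.gcd_mul_left]
  rw [Int.natAbs_natCast, Nat.mul_div_mul_left _ _ hp]

lemma spec_div {M N p : ℕ} (hN : 0 < N) (h : N = p * M) {S L : Finset ℕ} (hs : Spec N S L)
    (hcong : ∀ a ∈ L, ∀ b ∈ L, a ≡ b [MOD p]) : Spec M S (L.image (· / p)) := by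
  have hp : 0 < p := Nat.pos_of_ne_zero (by rintro rfl; simp at h; omega)
  have hinj : Set.InjOn (· / p) (L : Set ℕ) := by
    intro a ha b hb hab
    simp only at hab
    have h1 : a % p = b % p := hcong a ha b hb
    rw [← Nat.div_add_mod a p, ← Nat.div_add_mod b p, hab, h1]
  refine ⟨by rw [Finset.card_image_of_injOn hinj, hs.card], ?_⟩
  intro a ha b hb hab
  rw [Finset.mem_image] at ha hb
  obtain ⟨a, ha, rfl⟩ := ha
  obtain ⟨b, hb, rfl⟩ := hb
  rw [od_div hp (hcong a ha b hb), ← h]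
  exact hs.orth a ha b hb (by rintro rfl; exact hab rfl)

lemma fiber_card {N M p : ℕ} (hN : 0 < N) (h : N = p * M) {S : Finset ℕ}
    (hinj : ∀ a ∈ S, ∀ b ∈ S, a ≡ b [MOD N] → a = b)
    (hper : ∀ x ∈ S, PerAt S N M x) {y : ℕ} (hy : y ∈ S.image (· % M)) :
    (S.filter (fun s => s % M = y)).card = p := by
  have hM : 0 < M := Nat.pos_of_ne_zero (by rintro rfl; simp at h; omega)
  obtain ⟨x, hx, rfl⟩ := Finset.mem_image.1 hy
  choose f hf hf' using hper x hx
  symm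
  rw [← Finset.card_range p]
  refine Finset.card_nbij f ?_ ?_ ?_
  · intro i _
    rw [Finset.mem_coe, Finset.mem_filter]
    refine ⟨hf i, ?_⟩
    have := (hf' i).of_dvd (show M ∣ N from ⟨p, by rw [h, mul_comm]⟩)
    simpa [Nat.ModEq] using this
  · intro i hi j hj hij
    have := (hf' i).symm.trans (hij ▸ hf' j)
    have h2 := Nat.ModEq.add_left_cancel' x this
    rw [h] at h2
    have h3 := Nat.ModEq.mul_right_cancel' hM.ne' h2
    simp only [Finset.coe_range, Set.mem_Iio] at hi hj
    exact h3.eq_of_lt_of_lt hi hj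
  · intro s hs
    simp only [Finset.coe_filter, Set.mem_ofPred_eq] at hs
    -- s ≡ x mod M; find i with s ≡ x + i M mod p M
    have h1 : (M : ℤ) ∣ (s : ℤ) - x := by
      have : x ≡ s [MOD M] := hs.2.symm
      exact (Nat.modEq_iff_dvd).1 this
    obtain ⟨c, hc⟩ := h1
    have hp : 0 < p := Nat.pos_of_ne_zero (by rintro rfl; simp at h; omega)
    have hpz : (p : ℤ) ≠ 0 := by exact_mod_cast hp.ne'
    refine ⟨(c % p).toNat, ?_, ?_⟩
    · simp only [Finset.coe_range, Set.mem_Iio]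
      have := Int.emod_lt_of_pos c (show (0 : ℤ) < p by exact_mod_cast hp)
      have := Int.emod_nonneg c hpz
      omega
    · apply hinj _ (hf _) _ hs.1
      refine (hf' _).trans ?_
      rw [Nat.modEq_iff_dvd]
      push_cast
      rw [Int.toNat_of_nonneg (Int.emod_nonneg c hpz), h]
      refine ⟨c / p, ?_⟩
      have := Int.emod_add_mul_ediv c p
      have e : (s : ℤ) = x + M * c := by rw [← hc]; ring
      rw [e]; push_cast
      linear_combination (-(M : ℤ)) * this

/-- reduction when `S` is a union of cosets of `Z_p`. -/
lemma periodic_red {N M p : ℕ} (hN : 0 < N) (h : N = p * M) {S L : Finset ℕ}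
    (hs : Spec N S L) (hne : S.Nonempty)
    (hper : ∀ x ∈ S, PerAt S N M x)
    (ih : ∀ S' L' : Finset ℕ, S'.Nonempty → Spec M S' L' → Tile M S') : Tile N S := by
  have hinj := (hs.symm hN).inj hN
  have hp : 0 < p := Nat.pos_of_ne_zero (by rintro rfl; simp at h; omega)
  have hM : 0 < M := Nat.pos_of_ne_zero (by rintro rfl; simp at h; omega)
  set S' := S.image (· % M) with hS'
  have hcard : S.card = p * S'.card := by
    rw [Finset.card_eq_sum_card_image (· % M) S, Finset.sum_congr rfl
      (fun y hy => fiber_card hN h hinj hper hy)]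
    simp [mul_comm, hS']
  obtain ⟨c, hcp, hcc⟩ : ∃ c ∈ Finset.range p, S'.card ≤ (L.filter (fun a => a % p = c)).card := by
    apply Finset.exists_le_card_fiber_of_mul_le_card_of_maps_to
    · intro a _; exact Finset.mem_range.2 (Nat.mod_lt _ hp)
    · exact ⟨0, Finset.mem_range.2 hp⟩
    · rw [Finset.card_range, hs.card, hcard]
  obtain ⟨L', hL', hLc⟩ := Finset.exists_subset_card_eq hcc
  have hLL : ∀ a ∈ L', a ∈ L ∧ a % p = c := fun a ha => by
    simpa using hL' ha
  have hcong : ∀ a ∈ L', ∀ b ∈ L', a ≡ b [MOD p] := fun a ha b hb =>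
    ((hLL a ha).2.trans (hLL b hb).2.symm)
  have hspec : Spec N S' L' := by
    refine ⟨hLc, ?_⟩
    intro a ha b hb hab
    have hz := hs.orth a (hLL a ha).1 b (hLL b hb).1 hab
    have hd : od N a b ∣ M := (od_dvd_iff hN (by rw [h, mul_comm])).2 (hcong a ha b hb)
    have hdp := od_pos (a := a) (b := b) hN
    have hζ := Complex.isPrimitiveRoot_exp _ hdp.ne'
    rw [Z_iff hdp hζ] at hz ⊢
    set ζ := Complex.exp (2 * Real.pi * Complex.I / (od N a b : ℕ))
    have e : ∑ s ∈ S, ζ ^ s = ∑ s ∈ S, ζ ^ (s % M) :=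
      Finset.sum_congr rfl fun s _ => pow_of_modEq hζ hd (Nat.mod_modEq _ _).symm
    rw [e, Finset.sum_comp (fun y => ζ ^ y) (· % M)] at hz
    have e2 : ∑ y ∈ S.image (· % M), (S.filter (fun s => s % M = y)).card • ζ ^ y
        = ∑ y ∈ S', p • ζ ^ y := Finset.sum_congr rfl fun y hy => by
          rw [fiber_card hN h hinj hper hy]
    rw [e2, ← Finset.smul_sum, smul_eq_zero] at hz
    exact hz.resolve_left hp.ne'
  have hsp := spec_div hN h hspec hcong
  obtain ⟨T, hT, hdT⟩ := ih _ _ (hne.image _) hsp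
  refine ⟨T, by rw [hcard, mul_assoc, hT, h], ?_⟩
  intro s hs' s2 hs2 t ht t' ht' he
  have h1 := he.of_dvd (show M ∣ N from ⟨p, by rw [h, mul_comm]⟩)
  have h2 : s % M + t ≡ s2 % M + t' [MOD M] := by
    simpa [Nat.ModEq] using h1
  obtain ⟨h3, rfl⟩ := hdT _ (Finset.mem_image_of_mem _ hs') _ (Finset.mem_image_of_mem _ hs2) t ht t' ht' h2
  exact ⟨hinj s hs' s2 hs2 (Nat.ModEq.add_right_cancel' t he), rfl⟩

lemma card_dvd {p : ℕ} (hp : p.Prime) {S : Finset ℕ} (I : Finset ℕ) (hI : ∀ i ∈ I, i ≠ 0)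
    (h : ∀ i ∈ I, Z S (p ^ i)) : p ^ I.card ∣ S.card := by
  have h1 : ∏ i ∈ I, cyclotomic (p ^ i) ℤ ∣ F S := by
    apply Finset.prod_dvd_of_isRelPrime
    · intro i hi j hj hij
      have hi' := cyclotomic.irreducible (n := p ^ i) (pow_pos hp.pos i)
      have hj' := cyclotomic.irreducible (n := p ^ j) (pow_pos hp.pos j)
      refine (hi'.isRelPrime_iff_not_dvd).2 fun hd => hij ?_
      have ha := hi'.associated_of_dvd hj' hd
      have he := eq_of_monic_of_associated (cyclotomic.monic _ ℤ) (cyclotomic.monic _ ℤ) ha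
      exact Nat.pow_right_injective hp.two_le (cyclotomic_injective he)
    · exact h
  have h2 := eval_dvd (x := (1 : ℤ)) h1
  rw [eval_prod] at h2
  have e : ∏ i ∈ I, eval 1 (cyclotomic (p ^ i) ℤ) = (p : ℤ) ^ I.card := by
    rw [Finset.prod_congr rfl (g := fun _ => (p : ℤ)), Finset.prod_const]
    intro i hi
    obtain ⟨k, rfl⟩ := Nat.exists_eq_succ_of_ne_zero (hI i hi)
    have := Fact.mk hp
    exact eval_one_cyclotomic_prime_pow k
  rw [e] at h2
  have e2 : eval 1 (F S) = (S.card : ℤ) := by simp [F, eval_finsetSum]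
  rw [e2] at h2
  exact_mod_cast h2

lemma tile_of_mult {N P c n : ℕ} (hN : 0 < N) {L : Finset ℕ} (hc : 0 < c) (hn : 0 < n)
    (hcn : c * n ∣ N) (hPc : P ∣ c)
    (hdir : ∀ s ∈ L, ∀ s' ∈ L, ∀ i < n, ∀ i' < n, s + c * i ≡ s' + c * i' [MOD N] → s = s')
    (hcard : N ≤ L.card * n) :
    Tile N L ∧ ∀ d, d ∣ N → d ∣ P → d ≠ 1 → Z L d := by
  have hci : Function.Injective (fun i => c * i) := fun i j hij => Nat.eq_of_mul_eq_mul_left hc hij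
  set T := (Finset.range n).image (fun i => c * i) with hT
  have hTc : T.card = n := by rw [hT, Finset.card_image_of_injective _ hci, Finset.card_range]
  have hD : Direct N L T := by
    intro s hs s' hs' t ht t' ht' he
    rw [hT, Finset.mem_image] at ht ht'
    obtain ⟨i, hi, rfl⟩ := ht
    obtain ⟨i', hi', rfl⟩ := ht'
    rw [Finset.mem_range] at hi hi'
    have h1 := hdir s hs s' hs' i hi i' hi' he
    subst h1
    refine ⟨rfl, ?_⟩
    have h2 := (Nat.ModEq.add_left_cancel' s he).of_dvd hcn
    have h3 := Nat.ModEq.mul_left_cancel' hc.ne' h2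
    rw [h3.eq_of_lt_of_lt hi hi']
  have hle := hD.card_le hN
  have heq : L.card * T.card = N := le_antisymm hle (by rw [hTc]; exact hcard)
  refine ⟨⟨T, heq, hD⟩, ?_⟩
  intro d hd hdP hd1
  have hdp : 0 < d := Nat.pos_of_dvd_of_pos hd hN
  have hζ := Complex.isPrimitiveRoot_exp d hdp.ne'
  rw [Z_iff hdp hζ]
  have h1 := hD.sum_zero hN heq hd hd1 hζ
  refine (mul_eq_zero.1 h1).resolve_right ?_
  have e : ∀ t ∈ T, Complex.exp (2 * Real.pi * Complex.I / d) ^ t = 1 := by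
    intro t ht
    rw [hT, Finset.mem_image] at ht
    obtain ⟨i, _, rfl⟩ := ht
    rw [hζ.pow_eq_one_iff_dvd]
    exact (hdP.trans hPc).mul_right i
  rw [Finset.sum_congr rfl e]
  simp [hTc, hn.ne']

lemma full_p {p q a b N : ℕ} (hp : p.Prime) (hq : q.Prime) (hpq : p ≠ q) (hb : b ≤ 2)
    (hNe : N = p ^ a * q ^ b) {S L : Finset ℕ} (hs : Spec N S L) (hne : S.Nonempty)
    (h : ∀ i, 1 ≤ i → i ≤ a → Z S (p ^ i)) :
    Tile N L ∧ ∀ i, 1 ≤ i → i ≤ a → Z L (p ^ i) := by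
  have hP : 0 < p ^ a := pow_pos hp.pos a
  have hN : 0 < N := by rw [hNe]; exact Nat.mul_pos hP (pow_pos hq.pos b)
  have hinj := hs.inj hN
  have hk : 0 < L.card := by rw [hs.card]; exact Finset.card_pos.2 hne
  suffices hh : Tile N L ∧ ∀ d, d ∣ N → d ∣ p ^ a → d ≠ 1 → Z L d by
    refine ⟨hh.1, fun i h1 h2 => hh.2 _ ?_ (pow_dvd_pow p h2) ?_⟩
    · rw [hNe]; exact (pow_dvd_pow p h2).mul_right _
    · exact (Nat.one_lt_pow (by omega) hp.one_lt).ne'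
  have hdp : p ^ a ∣ L.card := by
    rw [hs.card]
    have := card_dvd hp (S := S) (Finset.Icc 1 a) (fun i hi => by
      rw [Finset.mem_Icc] at hi; omega) (fun i hi => by
      rw [Finset.mem_Icc] at hi; exact h i hi.1 hi.2)
    simpa using this
  have hcop : ∀ j, (p ^ a).Coprime (q ^ j) := fun j =>
    Nat.Coprime.pow _ _ ((Nat.coprime_primes hp hq).2 hpq)
  have hdq : ∀ I : Finset ℕ, (∀ i ∈ I, i ≠ 0) → (∀ i ∈ I, Z S (q ^ i)) →
      p ^ a * q ^ I.card ≤ L.card := by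
    intro I hI hZ
    have h1 := card_dvd hq I hI hZ
    rw [← hs.card] at h1
    exact Nat.le_of_dvd hk ((hcop _).mul_dvd_of_dvd_of_dvd hdp h1)
  have hfib : ∀ s ∈ L, ∀ s' ∈ L, s ≡ s' [MOD p ^ a] → s = s' ∨
      ∃ j, 1 ≤ j ∧ j ≤ b ∧ od N s s' = q ^ j ∧ Z S (q ^ j) := by
    intro s hs1 s' hs2 hss
    by_cases heq : s = s'
    · exact Or.inl heq
    · right
      have h1 : od N s s' ∣ q ^ b := (od_dvd_iff hN (by rw [hNe, mul_comm])).2 hss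
      obtain ⟨j, hj, hj'⟩ := (Nat.dvd_prime_pow hq).1 h1
      have hz := hs.orth s hs1 s' hs2 heq
      rw [hj'] at hz
      refine ⟨j, ?_, hj, hj', hz⟩
      by_contra hj0
      have : j = 0 := by omega
      subst this
      rw [pow_zero] at hz
      exact hne.ne_empty (Z_one hz)
  -- full case
  have hfull : N ≤ L.card → Tile N L ∧ ∀ d, d ∣ N → d ∣ p ^ a → d ≠ 1 → Z L d := by
    intro hle
    refine tile_of_mult hN (c := N) (n := 1) hN one_pos (by simp) ⟨q ^ b, hNe⟩ ?_ (by simpa using hle)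
    intro s h1 s' h2 i hi i' hi' he
    have e1 : i = 0 := by omega
    have e2 : i' = 0 := by omega
    subst e1; subst e2
    exact hinj s h1 s' h2 (by simpa using he)
  have modP : ∀ {s s' c i i' : ℕ}, p ^ a ∣ c → s + c * i ≡ s' + c * i' [MOD N] →
      s ≡ s' [MOD p ^ a] := by
    intro s s' c i i' hc he
    have h1 := he.of_dvd (show p ^ a ∣ N from ⟨q ^ b, hNe⟩)
    obtain ⟨c, rfl⟩ := hc
    simpa [Nat.ModEq, mul_assoc] using h1
  have hnone : (∀ j, 1 ≤ j → j ≤ b → ¬ Z S (q ^ j)) →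
      Tile N L ∧ ∀ d, d ∣ N → d ∣ p ^ a → d ≠ 1 → Z L d := by
    intro hno
    refine tile_of_mult hN (c := p ^ a) (n := q ^ b) hP (pow_pos hq.pos _) (by rw [hNe]) dvd_rfl ?_ ?_
    · intro s h1 s' h2 i hi i' hi' he
      rcases hfib s h1 s' h2 (modP dvd_rfl he) with h | ⟨j, h3, h4, _, h6⟩
      · exact h
      · exact absurd h6 (hno j h3 h4)
    · rw [hNe]; exact Nat.mul_le_mul_right _ (Nat.le_of_dvd hk hdp)
  by_cases h1 : Z S (q ^ 1)
  · by_cases h2 : Z S (q ^ 2)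
    · -- everything
      apply hfull
      have := hdq (Finset.Icc 1 b) (fun i hi => by rw [Finset.mem_Icc] at hi; omega) (by
        intro i hi
        rw [Finset.mem_Icc] at hi
        have : i = 1 ∨ i = 2 := by omega
        rcases this with rfl | rfl <;> assumption)
      simpa [hNe] using this
    · by_cases hb2 : b = 2
      · subst hb2
        have hc := hdq {1} (by simp) (by simpa using h1)
        refine tile_of_mult hN (c := p ^ a) (n := q) hP hq.pos
          (by rw [hNe]; exact Nat.mul_dvd_mul_left _ (dvd_pow_self q two_ne_zero)) dvd_rfl ?_ ?_
        · intro s hs1 s' hs2 i hi i' hi' he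
          rcases hfib s hs1 s' hs2 (modP dvd_rfl he) with h | ⟨j, h3, h4, h5, h6⟩
          · exact h
          · have hj : j = 1 := by
              have : j ≠ 2 := by rintro rfl; exact h2 h6
              omega
            subst hj
            have h7 : s ≡ s' [MOD p ^ a * q] :=
              (od_dvd_iff hN (e := q) (by rw [hNe]; ring)).1 (by rw [h5, pow_one])
            have h8 := Nat.ModEq.add_left_cancel h7
              (he.of_dvd ⟨q, by rw [hNe]; ring⟩)
            have h9 := (Nat.ModEq.mul_left_cancel' hP.ne' h8).eq_of_lt_of_lt hi hi'
            subst h9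
            exact hinj s hs1 s' hs2 (Nat.ModEq.add_right_cancel' _ he)
        · rw [hNe, pow_two, ← mul_assoc]
          exact Nat.mul_le_mul_right _ (by simpa using hc)
      · apply hfull
        have := hdq (Finset.Icc 1 b) (fun i hi => by rw [Finset.mem_Icc] at hi; omega) (by
          intro i hi
          rw [Finset.mem_Icc] at hi
          have : i = 1 := by omega
          subst this; assumption)
        simpa [hNe] using this
  · by_cases h2 : b = 2 ∧ Z S (q ^ 2)
    · obtain ⟨rfl, h2⟩ := h2
      have hc := hdq {2} (by simp) (by simpa using h2)
      refine tile_of_mult hN (c := p ^ a * q) (n := q) (Nat.mul_pos hP hq.pos) hq.pos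
          (by rw [hNe, pow_two, mul_assoc]) (dvd_mul_right _ _) ?_ ?_
      · intro s hs1 s' hs2 i hi i' hi' he
        rcases hfib s hs1 s' hs2 (modP (dvd_mul_right _ _) he) with h | ⟨j, h3, h4, h5, h6⟩
        · exact h
        · exfalso
          have hj : j = 2 := by
            have : j ≠ 1 := by rintro rfl; exact h1 h6
            omega
          subst hj
          have h7 := he.of_dvd (show p ^ a * q ∣ N from ⟨q, by rw [hNe]; ring⟩)
          have h8 : s ≡ s' [MOD p ^ a * q] := by
            simpa [Nat.ModEq] using h7
          have h9 := (od_dvd_iff hN (e := q) (by rw [hNe]; ring)).2 h8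
          rw [h5] at h9
          have := Nat.le_of_dvd hq.pos h9
          have := hq.two_le
          nlinarith
      · rw [hNe, pow_two, ← mul_assoc]
        exact Nat.mul_le_mul_right _ (by simpa using hc)
    · apply hnone
      intro j hj hj' hz
      have : j = 1 ∨ j = 2 := by omega
      rcases this with rfl | rfl
      · exact h1 hz
      · exact h2 ⟨by omega, hz⟩

lemma full_p' {p q a b N : ℕ} (hp : p.Prime) (hq : q.Prime) (hpq : p ≠ q) (hb : b ≤ 2)
    (hNe : N = p ^ a * q ^ b) {S L : Finset ℕ} (hs : Spec N S L) (hne : S.Nonempty)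
    (h : ∀ i, 1 ≤ i → i ≤ a → Z L (p ^ i)) : Tile N S := by
  have hN : 0 < N := by rw [hNe]; exact Nat.mul_pos (pow_pos hp.pos a) (pow_pos hq.pos b)
  have hne' : L.Nonempty := by
    rw [← Finset.card_pos, hs.card]; exact Finset.card_pos.2 hne
  exact (full_p hp hq hpq hb hNe (hs.symm hN) hne' h).1

lemma all_cong {p q N : ℕ} (hN : 0 < N)
    (hpq : ∀ t, ¬ t.Coprime N → p ∣ t ∨ q ∣ t) {S L : Finset ℕ} (hs : Spec N S L)
    (hz : ¬ Z S N) : (∀ a ∈ L, ∀ b ∈ L, a ≡ b [MOD p]) ∨ (∀ a ∈ L, ∀ b ∈ L, a ≡ b [MOD q]) := by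
  have key : ∀ a ∈ L, ∀ b ∈ L, a ≡ b [MOD p] ∨ a ≡ b [MOD q] := by
    intro a ha b hb
    by_cases hab : a = b
    · subst hab; exact Or.inl rfl
    · have h1 := hs.orth a ha b hb hab
      have h2 : ¬ (((a : ℤ) - b).natAbs).Coprime N := by
        intro hc
        apply hz
        have : od N a b = N := by
          unfold od
          rw [Int.gcd_comm]
          have : Int.gcd ((a : ℤ) - b) N = 1 := hc
          rw [this, Nat.div_one]
        rwa [this] at h1
      rw [Nat.ModEq.comm, Nat.modEq_iff_dvd, Nat.ModEq.comm, Nat.modEq_iff_dvd,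
        Int.natCast_dvd, Int.natCast_dvd]
      exact hpq _ h2
  by_contra hcon
  simp only [not_or, not_forall] at hcon
  obtain ⟨⟨a, ha, b, hb, h1⟩, ⟨c, hc, d, hd, h2⟩⟩ := hcon
  have hab := (key a ha b hb).resolve_left h1
  have hcd := (key c hc d hd).resolve_right h2
  have e1 := key a ha c hc
  have e2 := key a ha d hd
  have e3 := key b hb c hc
  have e4 := key b hb d hd
  simp only [Nat.ModEq] at *
  omega

lemma order_prime {p N u x : ℕ} (hp : p.Prime) (hN : 0 < N) (h : N = p * u) {S L : Finset ℕ}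
    (hs : Spec N L S) (hx : x ∈ S) (hper : PerAt S N u x) : Z L p := by
  obtain ⟨y, hy, hyx⟩ := hper 1
  rw [one_mul] at hyx
  have hne : y ≠ x := by
    rintro rfl
    have h1 : y + 0 ≡ y + u [MOD N] := by simpa using hyx
    have h2 := Nat.ModEq.add_left_cancel' y h1
    have h3 := (Nat.modEq_zero_iff_dvd).1 h2.symm
    have hu : 0 < u := Nat.pos_of_ne_zero (by rintro rfl; simp at h; omega)
    have := Nat.le_of_dvd hu h3
    have := hp.two_le
    nlinarith
  have hz := hs.orth y hy x hx hne
  have h1 : od N y x ∣ p := (od_dvd_iff hN h).2 (by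
    have := hyx.of_dvd (show u ∣ N from ⟨p, by rw [h, mul_comm]⟩)
    simpa [Nat.ModEq] using this)
  rcases (Nat.dvd_prime hp).1 h1 with h2 | h2
  · rw [h2] at hz
    have h3 := Z_one hz
    have h4 := hs.card
    rw [h3] at h4
    simp at h4
    simp [h4] at hx
  · rwa [h2] at hz

lemma exists_shift {N p u t x : ℕ} (hN : 0 < N) (h : N = p * u) (ht : t ≡ x [MOD u]) :
    ∃ i, t ≡ x + i * u [MOD N] := by
  have hp : 0 < p := Nat.pos_of_ne_zero (by rintro rfl; simp at h; omega)
  have hpz : (p : ℤ) ≠ 0 := by exact_mod_cast hp.ne'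
  obtain ⟨c, hc⟩ := (Nat.modEq_iff_dvd).1 ht.symm
  refine ⟨(c % p).toNat, ?_⟩
  rw [Nat.ModEq.comm, Nat.modEq_iff_dvd]
  push_cast
  rw [Int.toNat_of_nonneg (Int.emod_nonneg c hpz), h]
  refine ⟨c / p, ?_⟩
  have := Int.emod_add_mul_ediv c p
  have e : (t : ℤ) = x + u * c := by rw [← hc]; ring
  rw [e]; push_cast
  linear_combination (-(u : ℤ)) * this

lemma PerAt.shift {N p u t x : ℕ} {S : Finset ℕ} (hN : 0 < N) (h : N = p * u)
    (ht : t ≡ x [MOD u]) (hper : PerAt S N u x) : PerAt S N u t := by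
  obtain ⟨i0, hi0⟩ := exists_shift hN h ht
  intro i
  obtain ⟨y, hy, hyx⟩ := hper (i0 + i)
  refine ⟨y, hy, hyx.trans ?_⟩
  rw [add_mul, ← add_assoc]
  exact (hi0.add_right _).symm

lemma sat_card {p : ℕ} (hp : p.Prime) {S P : Finset ℕ} (hz : Z S p) (hPS : P ⊆ S)
    (hsat : ∀ x ∈ P, ∀ s ∈ S, x ≡ s [MOD p] → s ∈ P) :
    p * P.card = (P.image (· % p)).card * S.card := by
  rw [Finset.card_eq_sum_card_image (· % p) P, Finset.mul_sum, ← smul_eq_mul, ← Finset.sum_const]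
  refine Finset.sum_congr rfl fun c hc => ?_
  obtain ⟨x, hx, rfl⟩ := Finset.mem_image.1 hc
  rw [← equidist hp hz x, cnt]
  congr 2
  ext s
  simp only [Finset.mem_filter]
  constructor
  · rintro ⟨h1, h2⟩; exact ⟨hPS h1, h2⟩
  · rintro ⟨h1, h2⟩; exact ⟨hsat x hx s h1 h2.symm, h2⟩

lemma cross {p q N : ℕ} (hp : p.Prime) (hq : q.Prime) (hpq : p ≠ q) (hNe : N = p ^ 2 * q ^ 2)
    {S L : Finset ℕ} (hs : Spec N L S) (hzq : ¬ Z L (q ^ 2)) {x y : ℕ}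
    (hper : PerAt S N (p * q ^ 2) x) (hy : y ∈ S) (hxy : x ≡ y [MOD p]) : x ≡ y [MOD q] := by
  have hN : 0 < N := by rw [hNe]; exact Nat.mul_pos (pow_pos hp.pos _) (pow_pos hq.pos _)
  by_contra hcon
  have hcop : (p ^ 2).Coprime (q ^ 2) := Nat.Coprime.pow _ _ ((Nat.coprime_primes hp hq).2 hpq)
  have hcop1 : p.Coprime (q ^ 2) := Nat.Coprime.pow_right _ ((Nat.coprime_primes hp hq).2 hpq)
  obtain ⟨t, ht1, ht2⟩ := Nat.chineseRemainder hcop y x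
  have ht : t ≡ x [MOD p * q ^ 2] := by
    rw [← Nat.modEq_and_modEq_iff_modEq_mul hcop1]
    exact ⟨(ht1.of_dvd (dvd_pow_self p two_ne_zero)).trans hxy.symm, ht2⟩
  obtain ⟨s, hsS, hst⟩ := (hper.shift hN (show N = p * (p * q ^ 2) by rw [hNe]; ring) ht) 0
  simp only [zero_mul, add_zero] at hst
  have h1 : s ≡ y [MOD p ^ 2] := (hst.of_dvd ⟨q ^ 2, hNe⟩).trans ht1
  have h2 : s ≡ x [MOD q] := ((hst.of_dvd ⟨p ^ 2, by rw [hNe]; ring⟩).trans ht2).of_dvd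
    (dvd_pow_self q two_ne_zero)
  have hne : s ≠ y := by rintro rfl; exact hcon h2.symm
  have hz := hs.orth s hsS y hy hne
  have h3 : od N s y ∣ q ^ 2 := (od_dvd_iff hN (by rw [hNe]; ring)).2 h1
  obtain ⟨j, hj, hj'⟩ := (Nat.dvd_prime_pow hq).1 h3
  have hj2 : j = 2 := by
    by_contra hj2
    have h4 : od N s y ∣ q := by
      rw [hj']
      calc q ^ j ∣ q ^ 1 := pow_dvd_pow q (by omega)
        _ = q := pow_one q
    have h5 := (od_dvd_iff (f := p ^ 2 * q) hN (by rw [hNe]; ring)).1 h4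
    exact hcon (h2.symm.trans (h5.of_dvd (dvd_mul_left _ _)))
  rw [hj', hj2] at hz
  exact hzq hz

lemma final_contra {p q N : ℕ} (hp : p.Prime) (hq : q.Prime) (hpq : p ≠ q)
    (hNe : N = p ^ 2 * q ^ 2) (hc : ∀ t, ¬ t.Coprime N → p ∣ t ∨ q ∣ t)
    {S L : Finset ℕ} (hs : Spec N L S) (hzN : Z S N) (hzp : Z S p) (hzq : Z S q)
    (hp2 : ¬ Z L (p ^ 2)) (hq2 : ¬ Z L (q ^ 2)) {x0 y0 : ℕ}
    (hx0 : x0 ∈ S) (hx0' : ¬ PerAt S N (p * q ^ 2) x0)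
    (hy0 : y0 ∈ S) (hy0' : ¬ PerAt S N (q * p ^ 2) y0) : False := by
  classical
  have hN : 0 < N := by rw [hNe]; exact Nat.mul_pos (pow_pos hp.pos _) (pow_pos hq.pos _)
  have hu : N = p * (p * q ^ 2) := by rw [hNe]; ring
  have hv : N = q * (q * p ^ 2) := by rw [hNe]; ring
  have hinj := hs.inj hN
  have hll : ∀ x ∈ S, PerAt S N (p * q ^ 2) x ∨ PerAt S N (q * p ^ 2) x :=
    fun x hx => lam_leung hN hu hv hc hzN hx
  set P := S.filter (fun x => ¬ PerAt S N (q * p ^ 2) x) with hP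
  have hPm : ∀ x, x ∈ P ↔ x ∈ S ∧ ¬ PerAt S N (q * p ^ 2) x := fun x => by simp [hP]
  have hcop : (p ^ 2).Coprime (q ^ 2) := Nat.Coprime.pow _ _ ((Nat.coprime_primes hp hq).2 hpq)
  have hcop1 : p.Coprime (q ^ 2) := Nat.Coprime.pow_right _ ((Nat.coprime_primes hp hq).2 hpq)
  have hcop2 : q.Coprime (p ^ 2) := Nat.Coprime.pow_right _ ((Nat.coprime_primes hq hp).2 hpq.symm)
  have hboth : ∀ x ∈ P, ∀ y ∈ S, PerAt S N (q * p ^ 2) y → x ≡ y [MOD p] → x ≡ y [MOD q] →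
      False := by
    intro x hx y hy hyper h1 h2
    obtain ⟨hxS, hxn⟩ := (hPm x).1 hx
    have hxper := (hll x hxS).resolve_right hxn
    obtain ⟨t, ht1, ht2⟩ := Nat.chineseRemainder hcop y x
    have htx : t ≡ x [MOD p * q ^ 2] := by
      rw [← Nat.modEq_and_modEq_iff_modEq_mul hcop1]
      exact ⟨(ht1.of_dvd (dvd_pow_self p two_ne_zero)).trans h1.symm, ht2⟩
    have hty : t ≡ y [MOD q * p ^ 2] := by
      rw [← Nat.modEq_and_modEq_iff_modEq_mul hcop2]
      exact ⟨(ht2.of_dvd (dvd_pow_self q two_ne_zero)).trans h2, ht1⟩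
    have a1 := hxper.shift hN hu htx
    have a2 := hyper.shift hN hv hty
    obtain ⟨i, hi⟩ := exists_shift hN hu htx.symm
    have a3 := full_rect hN hu hv hc hzN hinj a1 a2 i
    exact hxn (a3.shift hN hv (hi.of_dvd ⟨q, by rw [hv]; ring⟩))
  have hdp : ∀ x ∈ P, ∀ y ∈ S, PerAt S N (q * p ^ 2) y → ¬ x ≡ y [MOD p] := by
    intro x hx y hy hyper h1
    obtain ⟨hxS, hxn⟩ := (hPm x).1 hx
    have hxper := (hll x hxS).resolve_right hxn
    exact hboth x hx y hy hyper h1 (cross hp hq hpq hNe hs hq2 hxper hy h1)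
  have hdq : ∀ x ∈ P, ∀ y ∈ S, PerAt S N (q * p ^ 2) y → ¬ x ≡ y [MOD q] := by
    intro x hx y hy hyper h1
    obtain ⟨hxS, hxn⟩ := (hPm x).1 hx
    exact hboth x hx y hy hyper
      (cross hq hp hpq.symm (by rw [hNe, mul_comm]) hs hp2 hyper hxS h1.symm).symm h1
  have hPS : P ⊆ S := Finset.filter_subset _ _
  have e1 := sat_card hp hzp hPS (fun x hx s hsS hxs => by
    rw [hPm]; exact ⟨hsS, fun hper => hdp x hx s hsS hper hxs⟩)
  have e2 := sat_card hq hzq hPS (fun x hx s hsS hxs => by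
    rw [hPm]; exact ⟨hsS, fun hper => hdq x hx s hsS hper hxs⟩)
  set A := P.image (· % p) with hA
  set C := P.image (· % q)
  have hApos : 0 < A.card := Finset.card_pos.2 ⟨_, Finset.mem_image_of_mem _ ((hPm y0).2 ⟨hy0, hy0'⟩)⟩
  have hAlt : A.card < p := by
    have hss : A ⊆ (Finset.range p).erase (x0 % p) := by
      intro c hcA
      obtain ⟨x, hx, rfl⟩ := Finset.mem_image.1 hcA
      rw [Finset.mem_erase, Finset.mem_range]
      exact ⟨fun he => hdp x hx x0 hx0 ((hll x0 hx0).resolve_left hx0') he, Nat.mod_lt _ hp.pos⟩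
    have := Finset.card_le_card hss
    rw [Finset.card_erase_of_mem (Finset.mem_range.2 (Nat.mod_lt _ hp.pos)), Finset.card_range] at this
    have := hp.pos
    omega
  have hSpos : 0 < S.card := Finset.card_pos.2 ⟨x0, hx0⟩
  have e3 : A.card * q = C.card * p := by
    apply Nat.eq_of_mul_eq_mul_right hSpos
    calc A.card * q * S.card = q * (A.card * S.card) := by ring
      _ = p * (q * P.card) := by rw [← e1]; ring
      _ = C.card * p * S.card := by rw [e2]; ring
  have h4 : p ∣ A.card * q := ⟨C.card, by rw [e3, mul_comm]⟩
  have h5 := (Nat.Coprime.dvd_of_dvd_mul_right ((Nat.coprime_primes hp hq).2 hpq) h4)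
  have := Nat.le_of_dvd hApos h5
  omega

theorem fuglede_two {p q : ℕ} (hp : p.Prime) (hq : q.Prime) (hpq : p ≠ q) :
    ∀ n a b : ℕ, a + b = n → a ≤ 2 → b ≤ 2 → ∀ S L : Finset ℕ, S.Nonempty →
      Spec (p ^ a * q ^ b) S L → Tile (p ^ a * q ^ b) S := by
  intro n
  induction n with
  | zero =>
    intro a b hab ha hb S L hne hs
    obtain ⟨rfl, rfl⟩ : a = 0 ∧ b = 0 := by omega
    exact full_p' hp hq hpq (by omega) rfl hs hne (fun i h1 h2 => by omega)
  | succ n ih =>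
    intro a b hab ha hb S L hne hs
    set N := p ^ a * q ^ b with hNe
    have hNe' : N = q ^ b * p ^ a := by rw [hNe, mul_comm]
    have hN : 0 < N := Nat.mul_pos (pow_pos hp.pos _) (pow_pos hq.pos _)
    have hs' := hs.symm hN
    have hneL : L.Nonempty := by
      rw [← Finset.card_pos, hs.card]; exact Finset.card_pos.2 hne
    by_cases ha0 : a = 0
    · exact full_p' hp hq hpq hb hNe hs hne (fun i h1 h2 => by omega)
    by_cases hb0 : b = 0
    · exact full_p' hq hp hpq.symm ha hNe' hs hne (fun i h1 h2 => by omega)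
    set u := p ^ (a - 1) * q ^ b with hu'
    set v := p ^ a * q ^ (b - 1) with hv'
    have hu : N = p * u := by
      obtain ⟨a, rfl⟩ := Nat.exists_eq_succ_of_ne_zero ha0
      rw [hNe, hu', Nat.succ_sub_one, pow_succ]; ring
    have hv : N = q * v := by
      obtain ⟨b, rfl⟩ := Nat.exists_eq_succ_of_ne_zero hb0
      rw [hNe, hv', Nat.succ_sub_one, pow_succ]; ring
    have hc : ∀ t, ¬ t.Coprime N → p ∣ t ∨ q ∣ t := by
      intro t ht
      by_contra hcon
      rw [not_or] at hcon
      apply ht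
      have h1 := ((Nat.Prime.coprime_iff_not_dvd hp).2 hcon.1).symm
      have h2 := ((Nat.Prime.coprime_iff_not_dvd hq).2 hcon.2).symm
      exact Nat.Coprime.mul_right (h1.pow_right _) (h2.pow_right _)
    have ihu : ∀ S' L' : Finset ℕ, S'.Nonempty → Spec u S' L' → Tile u S' :=
      ih (a - 1) b (by omega) (by omega) hb
    have ihv : ∀ S' L' : Finset ℕ, S'.Nonempty → Spec v S' L' → Tile v S' :=
      ih a (b - 1) (by omega) ha (by omega)
    have hupos : 0 < u := Nat.pos_of_ne_zero (by rintro h; rw [h] at hu; simp at hu; omega)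
    have hvpos : 0 < v := Nat.pos_of_ne_zero (by rintro h; rw [h] at hv; simp at hv; omega)
    by_cases hzS : Z S N
    swap
    · rcases all_cong hN hc hs hzS with h | h
      · exact tile_up hN hu hne (ihu _ _ hne (spec_div hN hu hs h))
      · exact tile_up hN hv hne (ihv _ _ hne (spec_div hN hv hs h))
    by_cases hzL : Z L N
    swap
    · rcases all_cong hN hc hs' hzL with h | h
      · exact tile_up' hN hu hne h (ihu _ _ (hne.image _) ((spec_div hN hu hs' h).symm hupos))
      · exact tile_up' hN hv hne h (ihv _ _ (hne.image _) ((spec_div hN hv hs' h).symm hvpos))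
    by_cases hpu : ∀ x ∈ S, PerAt S N u x
    · exact periodic_red hN hu hs hne hpu ihu
    by_cases hpv : ∀ x ∈ S, PerAt S N v x
    · exact periodic_red hN hv hs hne hpv ihv
    push Not at hpu hpv
    obtain ⟨x0, hx0, hx0'⟩ := hpu
    obtain ⟨y0, hy0, hy0'⟩ := hpv
    have hLq : Z L q := order_prime hq hN hv hs' hx0
      ((lam_leung hN hu hv hc hzS hx0).resolve_left hx0')
    have hLp : Z L p := order_prime hp hN hu hs' hy0
      ((lam_leung hN hu hv hc hzS hy0).resolve_right hy0')
    by_cases hfp : ∀ i, 1 ≤ i → i ≤ a → Z L (p ^ i)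
    · exact full_p' hp hq hpq hb hNe hs hne hfp
    by_cases hfq : ∀ i, 1 ≤ i → i ≤ b → Z L (q ^ i)
    · exact full_p' hq hp hpq.symm ha hNe' hs hne hfq
    have hp2 : a = 2 ∧ ¬ Z L (p ^ 2) := by
      push Not at hfp
      obtain ⟨i, h1, h2, h3⟩ := hfp
      have : i ≠ 1 := by rintro rfl; rw [pow_one] at h3; exact h3 hLp
      obtain rfl : i = 2 := by omega
      exact ⟨by omega, h3⟩
    have hq2 : b = 2 ∧ ¬ Z L (q ^ 2) := by
      push Not at hfq
      obtain ⟨i, h1, h2, h3⟩ := hfq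
      have : i ≠ 1 := by rintro rfl; rw [pow_one] at h3; exact h3 hLq
      obtain rfl : i = 2 := by omega
      exact ⟨by omega, h3⟩
    obtain ⟨rfl, hp2⟩ := hp2
    obtain ⟨rfl, hq2⟩ := hq2
    have hue : u = p * q ^ 2 := by rw [hu']; norm_num
    have hve : v = q * p ^ 2 := by rw [hv']; norm_num [mul_comm]
    have hinjL := hs.inj hN
    have hcp : ∀ {p q : ℕ}, p.Prime → q.Prime → p ≠ q → ¬ p ^ 2 ∣ p * q ^ 2 := by
      intro p q hp hq hpq hd
      rw [pow_two, Nat.mul_dvd_mul_iff_left hp.pos] at hd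
      exact hpq ((Nat.prime_dvd_prime_iff_eq hp hq).1 (hp.dvd_of_dvd_pow hd))
    by_cases hLu : ∀ x ∈ L, PerAt L N u x
    · exact absurd (periodic_Z (pow_pos hp.pos 2) ⟨q ^ 2, hNe⟩ (by rw [hue]; exact hcp hp hq hpq) hinjL hLu) hp2
    by_cases hLv : ∀ x ∈ L, PerAt L N v x
    · exact absurd (periodic_Z (pow_pos hq.pos 2) ⟨p ^ 2, hNe'⟩ (by rw [hve]; exact hcp hq hp hpq.symm) hinjL hLv) hq2
    push Not at hLu hLv
    obtain ⟨x1, hx1, hx1'⟩ := hLu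
    obtain ⟨y1, hy1, hy1'⟩ := hLv
    have hSq : Z S q := order_prime hq hN hv hs hx1
      ((lam_leung hN hu hv hc hzL hx1).resolve_left hx1')
    have hSp : Z S p := order_prime hp hN hu hs hy1
      ((lam_leung hN hu hv hc hzL hy1).resolve_right hy1')
    rw [hue] at hx0'
    rw [hve] at hy0'
    exact (final_contra hp hq hpq hNe hc hs' hzS hSp hSq hp2 hq2 hx0 hx0' hy0 hy0').elim

/-- passing from `ℤ/(m r)` to `ℤ/m` for small sets -/
lemma spec_drop {m r : ℕ} (hm : 0 < m) (hr : r.Prime) (hc : m.Coprime r) {S L : Finset ℕ}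
    (hs : Spec (m * r) S L) (hcard : S.card < r) : Spec m S L := by
  have hN : 0 < m * r := Nat.mul_pos hm hr.pos
  refine ⟨hs.card, fun a ha b hb hab => ?_⟩
  have hz := hs.orth a ha b hb hab
  have hdm : od m a b ∣ m := od_dvd m a b
  have hcd : (od m a b).Coprime r := hc.coprime_dvd_left hdm
  -- od m a b * r is a multiple of od (m r) a b
  have h1 : od (m * r) a b ∣ od m a b * r := by
    obtain ⟨f, hf⟩ := hdm
    refine (od_dvd_iff (f := f) hN ?_).2 ((od_dvd_iff hm hf).1 dvd_rfl)
    conv_lhs => rw [hf]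
    ring
  have hcop := hc
  by_cases hrd : r ∣ od (m * r) a b
  · obtain ⟨e, he⟩ := hrd
    rw [he, mul_comm r e] at h1 hz
    have hed : e ∣ od m a b := Nat.dvd_of_mul_dvd_mul_right hr.pos h1
    have hde : od m a b ∣ e := by
      obtain ⟨f, hf⟩ := hed.trans hdm
      refine (od_dvd_iff hm hf).2 ?_
      refine (od_dvd_iff (e := e * r) (f := f) hN ?_).1 (by rw [he, mul_comm])
      conv_lhs => rw [hf]
      ring
    have := Nat.dvd_antisymm hed hde
    subst this
    exact drop_r hr (od_pos hm) hcd hcard hz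
  · have hcr : (od (m * r) a b).Coprime r := ((Nat.Prime.coprime_iff_not_dvd hr).2 hrd).symm
    have hed : od (m * r) a b ∣ od m a b := hcr.dvd_of_dvd_mul_right h1
    have hde : od m a b ∣ od (m * r) a b := by
      obtain ⟨f, hf⟩ := hed.trans hdm
      refine (od_dvd_iff hm hf).2 ?_
      refine Nat.ModEq.of_dvd (dvd_mul_right f r)
        ((od_dvd_iff (e := od (m * r) a b) (f := f * r) hN ?_).1 dvd_rfl)
      conv_lhs => rw [hf]
      ring
    rw [Nat.dvd_antisymm hde hed]
    exact hz

/-- large sets: two elements of `L` differ by an element of order `r`. -/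
lemma large_Z {m r : ℕ} (hm : 0 < m) (hr : r.Prime) {S L : Finset ℕ}
    (hs : Spec (m * r) S L) (hcard : m < L.card) : Z S r := by
  have hN : 0 < m * r := Nat.mul_pos hm hr.pos
  obtain ⟨a, ha, b, hb, hab, he⟩ := Finset.exists_ne_map_eq_of_card_lt_of_maps_to
    (s := L) (t := Finset.range m) (by simpa using hcard) (f := (· % m))
    (fun a _ => Finset.mem_range.2 (Nat.mod_lt _ hm))
  have hz := hs.orth a ha b hb hab
  have h1 : od (m * r) a b ∣ r := (od_dvd_iff hN (mul_comm _ _)).2 he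
  rcases (Nat.dvd_prime hr).1 h1 with h2 | h2
  · rw [h2] at hz
    have h3 := hs.card
    rw [Z_one hz] at h3
    simp at h3
    simp [h3] at ha
  · rwa [h2] at hz

/-- set of representatives -/
noncomputable def nat {n : ℕ} (S : Finset (ZMod n)) : Finset ℕ := S.image ZMod.val

lemma nat_card {n : ℕ} [NeZero n] (S : Finset (ZMod n)) : (nat S).card = S.card :=
  Finset.card_image_of_injective _ (ZMod.val_injective n)

lemma F_nat {n : ℕ} [NeZero n] (S : Finset (ZMod n)) : F (nat S) = maskPoly n S := by
  unfold F nat maskPoly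
  rw [Finset.sum_image (fun a _ b _ h => ZMod.val_injective n h)]

lemma spec_of {n : ℕ} [NeZero n] {S L : Finset (ZMod n)} (h : SpectralPair n S L) :
    Spec n (nat S) (nat L) := by
  have hn : 0 < n := Nat.pos_of_ne_zero (NeZero.ne n)
  refine ⟨by rw [nat_card, nat_card, h.1], ?_⟩
  intro a ha b hb hab
  obtain ⟨x, hx, rfl⟩ := Finset.mem_image.1 ha
  obtain ⟨y, hy, rfl⟩ := Finset.mem_image.1 hb
  have hxy : x ≠ y := by rintro rfl; exact hab rfl
  have h2 := h.2 x hx y hy hxy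
  have hζ := Complex.isPrimitiveRoot_exp n hn.ne'
  rw [Z_iff (od_pos hn) (prim_od hn hζ), nat, Finset.sum_image (fun a _ b _ h => ZMod.val_injective n h),
    ← h2]
  refine Finset.sum_congr rfl fun s _ => ?_
  set ζ := Complex.exp (2 * Real.pi * Complex.I / n) with hzdef
  have e1 : ζ ^ x.val * (ζ ^ y.val)⁻¹ = ζ ^ (x - y).val := by
    rw [mul_inv_eq_iff_eq_mul₀ (pow_ne_zero _ (hζ.ne_zero hn.ne')), ← pow_add]
    apply pow_of_modEq hζ dvd_rfl
    rw [← ZMod.natCast_eq_natCast_iff]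
    simp
  rw [e1, ← pow_mul, hzdef, ← Complex.exp_nat_mul]
  congr 1
  ring

lemma isTile_of {n : ℕ} [NeZero n] {S : Finset (ZMod n)} (h : Tile n (nat S)) : IsTile n S := by
  classical
  obtain ⟨T, hc, hd⟩ := h
  have hn : 0 < n := Nat.pos_of_ne_zero (NeZero.ne n)
  have hmem : ∀ s ∈ S, s.val ∈ nat S := fun s hs => Finset.mem_image_of_mem _ hs
  have key : ∀ s ∈ S, ∀ s' ∈ S, ∀ t ∈ T, ∀ t' ∈ T, s + (t : ZMod n) = s' + (t' : ZMod n) →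
      s = s' ∧ t = t' := by
    intro s hs s' hs' t ht t' ht' he
    have := hd _ (hmem s hs) _ (hmem s' hs') t ht t' ht' (by
      rw [← ZMod.natCast_eq_natCast_iff]
      simpa using he)
    exact ⟨ZMod.val_injective n this.1, this.2⟩
  have hinj : Set.InjOn (fun st : ZMod n × ℕ => st.1 + (st.2 : ZMod n)) (S ×ˢ T : Finset (ZMod n × ℕ)) := by
    rintro ⟨s, t⟩ h1 ⟨s', t'⟩ h2 he
    simp only [Finset.coe_product, Set.mem_prod, Finset.mem_coe] at h1 h2
    obtain ⟨a, b⟩ := key s h1.1 s' h2.1 t h1.2 t' h2.2 he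
    simp [a, b]
  have hsurj : (S ×ˢ T).image (fun st : ZMod n × ℕ => st.1 + (st.2 : ZMod n)) = Finset.univ := by
    rw [← Finset.card_eq_iff_eq_univ, Finset.card_image_of_injOn hinj, Finset.card_product, ZMod.card,
      ← nat_card S, hc]
  refine ⟨T.image (fun t : ℕ => (t : ZMod n)), fun g => ?_⟩
  have hg : g ∈ (S ×ˢ T).image (fun st : ZMod n × ℕ => st.1 + (st.2 : ZMod n)) := by
    rw [hsurj]; exact Finset.mem_univ g
  obtain ⟨⟨s, t⟩, hst, rfl⟩ := Finset.mem_image.1 hg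
  rw [Finset.mem_product] at hst
  refine ⟨(s, (t : ZMod n)), ⟨hst.1, Finset.mem_image_of_mem _ hst.2, rfl⟩, ?_⟩
  rintro ⟨s', t'⟩ ⟨h1, h2, h3⟩
  obtain ⟨t', ht', rfl⟩ := Finset.mem_image.1 h2
  obtain ⟨rfl, rfl⟩ := key s' h1 s hst.1 t' ht' t hst.2 h3
  rfl

end TileAux

theorem tile_or_phi_r
    (p q r : ℕ) (hp : p.Prime) (hq : q.Prime) (hr : r.Prime)
    (hpq : p ≠ q) (hpr : p ≠ r) (hqr : q ≠ r)
    (hle : p ^ 2 * q ^ 2 ≤ r)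
    (S Λ : Finset (ZMod (p ^ 2 * q ^ 2 * r)))
    (h : SpectralPair (p ^ 2 * q ^ 2 * r) S Λ) :
    IsTile (p ^ 2 * q ^ 2 * r) S ∨
      (cyclotomic r ℤ ∣ maskPoly (p ^ 2 * q ^ 2 * r) S ∧
       cyclotomic r ℤ ∣ maskPoly (p ^ 2 * q ^ 2 * r) Λ ∧
       r ∣ S.card) := by
  have hm : 0 < p ^ 2 * q ^ 2 := Nat.mul_pos (pow_pos hp.pos _) (pow_pos hq.pos _)
  have hN : 0 < p ^ 2 * q ^ 2 * r := Nat.mul_pos hm hr.pos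
  have : NeZero (p ^ 2 * q ^ 2 * r) := ⟨hN.ne'⟩
  have hc : (p ^ 2 * q ^ 2).Coprime r :=
    Nat.Coprime.mul_left (((Nat.coprime_primes hp hr).2 hpr).pow_left _)
      (((Nat.coprime_primes hq hr).2 hqr).pow_left _)
  have hlt : p ^ 2 * q ^ 2 < r := by
    refine lt_of_le_of_ne hle fun he => ?_
    rw [he, Nat.coprime_self] at hc
    exact hr.one_lt.ne' hc
  have hs := TileAux.spec_of h
  by_cases hcard : S.card < r
  · by_cases hne : S.Nonempty
    · left
      apply TileAux.isTile_of
      have h1 := TileAux.spec_drop hm hr hc hs (by rw [TileAux.nat_card]; exact hcard)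
      have hne' : (TileAux.nat S).Nonempty := hne.image _
      exact TileAux.tile_up hN (mul_comm _ _) hne'
        (TileAux.fuglede_two hp hq hpq 4 2 2 rfl le_rfl le_rfl _ _ hne' h1)
    · right
      rw [Finset.not_nonempty_iff_eq_empty] at hne
      subst hne
      have hL : Λ = ∅ := by simpa using h.1
      subst hL
      simp [maskPoly]
  · right
    have hS : TileAux.Z (TileAux.nat S) r := TileAux.large_Z hm hr hs (by
      rw [TileAux.nat_card, h.1]; omega)
    have hL : TileAux.Z (TileAux.nat Λ) r := TileAux.large_Z hm hr (hs.symm hN) (by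
      rw [TileAux.nat_card]; omega)
    refine ⟨?_, ?_, ?_⟩
    · rw [← TileAux.F_nat]; exact hS
    · rw [← TileAux.F_nat]; exact hL
    · rw [← TileAux.nat_card S]
      exact ⟨_, (TileAux.equidist hr hS 0).symm⟩
end

section
/- Let p be a prime, n ≥ 1, and let S be a nonempty subset of ℤ_{p^n}. Let k be the number of distinct additive orders occurring among the nonzero elements of the difference set S − S = {s − s' : s, s' ∈ S}. Then |S| ≤ p^k. -/
theorem digit_aux (p n : ℕ) (hp : p.Prime) (s t : ZMod (p ^ n)) (hst : s ≠ t)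
    (h : (s.val / (p ^ n / addOrderOf (s - t))) % p
      = (t.val / (p ^ n / addOrderOf (s - t))) % p) : False := by
  haveI : NeZero (p ^ n) := ⟨pow_ne_zero _ hp.ne_zero⟩
  have key : ∀ m : ℕ, m • (s - t) = 0 ↔ m * s.val ≡ m * t.val [MOD p ^ n] := by
    intro m
    rw [← ZMod.natCast_eq_natCast_iff]
    push_cast
    rw [ZMod.natCast_zmod_val, ZMod.natCast_zmod_val, nsmul_eq_mul, mul_sub, sub_eq_zero]
  have hdvd : addOrderOf (s - t) ∣ p ^ n := by
    apply addOrderOf_dvd_of_nsmul_eq_zero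
    simp
  obtain ⟨j, hj, ho⟩ := (Nat.dvd_prime_pow hp).1 hdvd
  have h0 := (key _).1 (addOrderOf_nsmul_eq_zero (s - t))
  rw [ho] at h h0
  rw [Nat.pow_div hj hp.pos] at h
  rcases j with _ | i
  · rw [pow_zero, AddMonoid.addOrderOf_eq_one_iff, sub_eq_zero] at ho
    exact hst ho
  have e1 : p ^ n = p ^ (i + 1) * p ^ (n - (i + 1)) := by
    rw [← pow_add]; congr 1; omega
  have e2 : p ^ n = p ^ i * (p ^ (n - (i + 1)) * p) := by
    rw [e1]; ring
  have h1 : s.val ≡ t.val [MOD p ^ (n - (i + 1))] := by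
    have h0' : p ^ (i + 1) * s.val ≡ p ^ (i + 1) * t.val
      [MOD p ^ (i + 1) * p ^ (n - (i + 1))] := e1 ▸ h0
    exact Nat.ModEq.mul_left_cancel' (pow_ne_zero _ hp.ne_zero) h0'
  have h2 : s.val ≡ t.val [MOD p ^ (n - (i + 1)) * p] := by
    unfold Nat.ModEq at h1 ⊢
    rw [Nat.mod_mul, Nat.mod_mul, h1, h]
  have h3 : p ^ i * s.val ≡ p ^ i * t.val [MOD p ^ n] := by
    have := Nat.ModEq.mul_left' (p ^ i) h2
    rwa [← e2] at this
  have h4 := addOrderOf_dvd_of_nsmul_eq_zero ((key _).2 h3)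
  rw [ho, Nat.pow_dvd_pow_iff_le_right hp.one_lt] at h4
  omega

theorem card_le_pow_of_orders
    (p : ℕ) (hp : p.Prime) (n : ℕ) (hn : 1 ≤ n)
    (S : Finset (ZMod (p ^ n))) (hS : S.Nonempty)
    (k : ℕ)
    (hk : k = ((((S ×ˢ S).image
        (fun st : ZMod (p ^ n) × ZMod (p ^ n) => st.1 - st.2)).erase 0).image
        addOrderOf).card) :
    S.card ≤ p ^ k := by
  subst hk
  set O := (((S ×ˢ S).image
        (fun st : ZMod (p ^ n) × ZMod (p ^ n) => st.1 - st.2)).erase 0).image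
        addOrderOf with hO
  let f : S → (O → Fin p) := fun s o => ⟨(s.1.val / (p ^ n / o.1)) % p, Nat.mod_lt _ hp.pos⟩
  have hf : Function.Injective f := by
    intro s t h
    by_contra hne
    have hne' : s.1 ≠ t.1 := fun e => hne (Subtype.ext e)
    have hm : addOrderOf (s.1 - t.1) ∈ O := by
      rw [hO]
      refine Finset.mem_image_of_mem _ (Finset.mem_erase.2 ⟨sub_ne_zero.2 hne', ?_⟩)
      exact Finset.mem_image.2 ⟨(s.1, t.1), Finset.mem_product.2 ⟨s.2, t.2⟩, rfl⟩
    exact digit_aux p n hp s.1 t.1 hne' (congrArg Fin.val (congrFun h ⟨_, hm⟩))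
  have := Fintype.card_le_of_injective f hf
  simpa using this
end

section
/- Let N ≥ 1 and let (S, Λ) be a spectral pair in ℤ_N with S nonempty. Suppose there exist a prime p and k ∈ ℕ such that N = p^k · gcd(N, |S|). Then S tiles ℤ_N. -/
open Polynomial in
lemma aux_dvd (N : ℕ) [NeZero N] (L : Finset (ZMod N)) (p : ℕ) (hp : p.Prime) (J : Finset ℕ)
    (hJ : ∀ j ∈ J, 1 ≤ j ∧ ∃ x : ZMod N, addOrderOf x = p ^ j ∧
      ∑ l ∈ L, ZMod.stdAddChar (l * x) = 0) : p ^ J.card ∣ L.card := by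
  set P : ℤ[X] := ∑ l ∈ L, X ^ l.val with hP
  have h1 : ∀ j ∈ J, cyclotomic (p ^ j) ℤ ∣ P := by
    intro j hj
    obtain ⟨hj1, x, hx, hs⟩ := hJ j hj
    have hprim : IsPrimitiveRoot (ZMod.stdAddChar x : ℂ) (p ^ j) := by
      rw [← hx]
      constructor
      · rw [← AddChar.map_nsmul_eq_pow, addOrderOf_nsmul_eq_zero, AddChar.map_zero_eq_one]
      · intro l hl
        rw [← AddChar.map_nsmul_eq_pow] at hl
        apply addOrderOf_dvd_of_nsmul_eq_zero
        apply ZMod.injective_stdAddChar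
        rw [hl, AddChar.map_zero_eq_one]
    have hpos : 0 < p ^ j := pow_pos hp.pos j
    rw [cyclotomic_eq_minpoly hprim hpos]
    apply minpoly.isIntegrallyClosed_dvd (hprim.isIntegral hpos)
    rw [hP, map_sum, ← hs]
    refine Finset.sum_congr rfl fun l _ => ?_
    rw [map_pow, aeval_X, ← AddChar.map_nsmul_eq_pow, nsmul_eq_mul, ZMod.natCast_zmod_val]
  have h2 : ∏ j ∈ J, cyclotomic (p ^ j) ℤ ∣ P := by
    apply Finset.prod_dvd_of_isRelPrime _ h1
    intro i hi j hj hij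
    have hirr : ∀ m : ℕ, Irreducible (cyclotomic (p ^ m) ℤ) :=
      fun m => cyclotomic.irreducible (pow_pos hp.pos m)
    refine ((hirr i).isRelPrime_iff_not_dvd).2 fun hd => hij ?_
    have ha := (hirr i).associated_of_dvd (hirr j) hd
    have he := eq_of_monic_of_associated (cyclotomic.monic _ _) (cyclotomic.monic _ _) ha
    exact Nat.pow_right_injective hp.two_le (cyclotomic_injective he)
  have h3 := eval_dvd (x := (1 : ℤ)) h2
  have := Fact.mk hp
  have h4 : eval (1 : ℤ) (∏ j ∈ J, cyclotomic (p ^ j) ℤ) = (p : ℤ) ^ J.card := by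
    rw [eval_prod, Finset.prod_congr rfl (g := fun _ => (p : ℤ)), Finset.prod_const]
    intro j hj
    obtain ⟨m, rfl⟩ := Nat.exists_eq_add_of_le' (hJ j hj).1
    exact eval_one_cyclotomic_prime_pow m
  have h5 : eval (1 : ℤ) P = L.card := by
    simp [hP, eval_finsetSum]
  rw [h4, h5] at h3
  exact_mod_cast h3

lemma aux_T (N : ℕ) [NeZero N] (p : ℕ) (hp : p.Prime) (I : Finset ℕ)
    (hI : ∀ i ∈ I, 1 ≤ i ∧ p ^ i ∣ N) :
    ∃ T : Finset (ZMod N), T.card = p ^ I.card ∧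
      ∀ t ∈ T, ∀ t' ∈ T, t ≠ t' → ∃ i ∈ I, addOrderOf (t - t') = p ^ i := by
  classical
  induction I using Finset.induction_on_max with
  | empty => exact ⟨{0}, by simp, by simp⟩
  | insert i I hmax ih =>
    obtain ⟨T, hT, hd⟩ := ih fun j hj => hI j (Finset.mem_insert_of_mem hj)
    obtain ⟨hi1, hiN⟩ := hI i (Finset.mem_insert_self _ _)
    have hni : i ∉ I := fun hh => lt_irrefl _ (hmax i hh)
    obtain ⟨r, hr⟩ := hiN
    have hN0 : N ≠ 0 := NeZero.ne N
    have hr0 : r ≠ 0 := by rintro rfl; simp at hr; exact hN0 hr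
    obtain ⟨m, rfl⟩ := Nat.exists_eq_add_of_le' hi1
    have key : ∀ t ∈ T, ∀ t' ∈ T, ∀ c < p, ∀ c' < p, c ≠ c' →
        addOrderOf ((t + (c : ZMod N) * r) - (t' + (c' : ZMod N) * r)) = p ^ (m + 1) := by
      intro t ht t' ht' c hc c' hc' hcc
      have h0 : (p : ZMod N) ^ m * (t - t') = 0 := by
        by_cases htt : t = t'
        · simp [htt]
        · obtain ⟨j, hj, hjo⟩ := hd t ht t' ht' htt
          have hjm : j ≤ m := Nat.lt_succ_iff.1 (hmax j hj)
          have : p ^ m • (t - t') = 0 := by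
            apply addOrderOf_dvd_iff_nsmul_eq_zero.1
            rw [hjo]; exact pow_dvd_pow _ hjm
          simpa [nsmul_eq_mul] using this
      have hNz : (p : ZMod N) ^ (m + 1) * r = 0 := by
        have := (ZMod.natCast_eq_zero_iff (p ^ (m + 1) * r) N).2 hr.dvd
        simpa using this
      have := Fact.mk hp
      apply addOrderOf_eq_prime_pow
      · intro hz
        rw [nsmul_eq_mul] at hz
        push_cast at hz
        have h6 : (((p ^ m * r * ((c : ℤ) - c') : ℤ)) : ZMod N) = 0 := by
          push_cast
          linear_combination hz - h0
        rw [ZMod.intCast_zmod_eq_zero_iff_dvd] at h6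
        rw [hr] at h6
        push_cast at h6
        have h7 : ((p : ℤ) ^ m * r) * p ∣ (p ^ m * r) * ((c : ℤ) - c') := by
          convert h6 using 1; ring
        have hne : ((p : ℤ) ^ m * r) ≠ 0 := by
          have := hp.ne_zero
          positivity
        have h8 := (mul_dvd_mul_iff_left hne).1 h7
        have h9 := Int.eq_zero_of_abs_lt_dvd h8 (by rw [abs_lt]; omega)
        omega
      · rw [nsmul_eq_mul]
        push_cast
        linear_combination (p : ZMod N) * h0 + ((c : ZMod N) - c') * hNz
    refine ⟨(T ×ˢ Finset.range p).image fun q => q.1 + (q.2 : ZMod N) * r, ?_, ?_⟩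
    · rw [Finset.card_image_of_injOn, Finset.card_product, hT, Finset.card_range,
        Finset.card_insert_of_notMem hni, pow_succ]
      rintro ⟨t, c⟩ h1 ⟨t', c'⟩ h2 h3
      simp only [Finset.coe_product, Set.mem_prod, Finset.mem_coe, Finset.mem_range] at h1 h2
      simp only at h3
      by_cases hcc : c = c'
      · subst hcc
        simpa using h3
      · have := key t h1.1 t' h2.1 c h1.2 c' h2.2 hcc
        rw [h3, sub_self, addOrderOf_zero] at this
        exact absurd this.symm (Nat.one_lt_pow (by omega) hp.one_lt).ne'
    · intro u hu u' hu' hne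
      simp only [Finset.mem_image, Finset.mem_product, Finset.mem_range, Prod.exists] at hu hu'
      obtain ⟨t, c, ⟨ht, hc⟩, rfl⟩ := hu
      obtain ⟨t', c', ⟨ht', hc'⟩, rfl⟩ := hu'
      by_cases hcc : c = c'
      · subst hcc
        obtain ⟨j, hj, hjo⟩ := hd t ht t' ht' (by rintro rfl; exact hne rfl)
        exact ⟨j, Finset.mem_insert_of_mem hj, by rw [add_sub_add_right_eq_sub, hjo]⟩
      · exact ⟨m + 1, Finset.mem_insert_self _ _, key t ht t' ht' c hc c' hc' hcc⟩

lemma aux_dual (N : ℕ) [NeZero N] (S L : Finset (ZMod N)) (hS : S.Nonempty)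
    (hc : L.card = S.card)
    (h : ∀ l ∈ L, ∀ m ∈ L, l ≠ m → ∑ s ∈ S, (ZMod.stdAddChar ((l - m) * s) : ℂ) = 0)
    (s s' : ZMod N) (hs : s ∈ S) (hs' : s' ∈ S) (hne : s ≠ s') :
    ∑ l ∈ L, (ZMod.stdAddChar (l * (s - s')) : ℂ) = 0 := by
  classical
  have hn : (S.card : ℂ) ≠ 0 := by
    simpa using hS.ne_empty
  let A : Matrix L S ℂ := fun l s => ZMod.stdAddChar (l.1 * s.1)
  let B : Matrix S L ℂ := fun s l => (S.card : ℂ)⁻¹ * ZMod.stdAddChar (-(l.1 * s.1))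
  have hAB : A * B = 1 := by
    ext l m
    rw [Matrix.mul_apply]
    have e : ∀ s : S, A l s * B s m = (S.card : ℂ)⁻¹ * ZMod.stdAddChar ((l.1 - m.1) * s.1) := by
      intro s
      simp only [A, B]
      rw [mul_left_comm, ← AddChar.map_add_eq_mul]
      congr 2; ring
    rw [Finset.sum_congr rfl fun s _ => e s, ← Finset.mul_sum,
      Finset.sum_coe_sort S (fun s => (ZMod.stdAddChar ((l.1 - m.1) * s) : ℂ))]
    by_cases hlm : l = m
    · subst hlm
      simp [hn]
    · rw [h l l.2 m m.2 (fun hh => hlm (Subtype.ext hh)), Matrix.one_apply_ne hlm, mul_zero]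
  have hBA : B * A = 1 := (Matrix.mul_eq_one_comm_of_card_eq _ _ _ (by simp [hc])).1 hAB
  have := congrFun (congrFun hBA ⟨s', hs'⟩) ⟨s, hs⟩
  rw [Matrix.one_apply_ne (by simpa using hne.symm), Matrix.mul_apply] at this
  have e : ∀ l : L, B ⟨s', hs'⟩ l * A l ⟨s, hs⟩
      = (S.card : ℂ)⁻¹ * ZMod.stdAddChar (l.1 * (s - s')) := by
    intro l
    simp only [A, B]
    rw [mul_assoc, ← AddChar.map_add_eq_mul]
    congr 2; ring
  rw [Finset.sum_congr rfl fun s _ => e s, ← Finset.mul_sum,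
      Finset.sum_coe_sort L (fun l => (ZMod.stdAddChar (l * (s - s')) : ℂ))] at this
  exact (mul_eq_zero.1 this).resolve_left (inv_ne_zero hn)

theorem big_sets_tile
    (N : ℕ) (hN : 1 ≤ N)
    (S Λ : Finset (ZMod N)) (hS : S.Nonempty)
    (h : SpectralPair N S Λ)
    (hbig : ∃ (p : ℕ) (k : ℕ), p.Prime ∧ N = p ^ k * Nat.gcd N S.card) :
    IsTile N S := by
  classical
  have : NeZero N := ⟨by omega⟩
  obtain ⟨p, k, hp, hNk⟩ := hbig
  obtain ⟨hcard, horth⟩ := h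
  have horth' : ∀ l ∈ Λ, ∀ m ∈ Λ, l ≠ m →
      ∑ s ∈ S, (ZMod.stdAddChar ((l - m) * s) : ℂ) = 0 := by
    intro l hl m hm hlm
    rw [← horth l hl m hm hlm]
    refine Finset.sum_congr rfl fun s _ => ?_
    have := ZMod.stdAddChar_coe (N := N) (((l - m).val * s.val : ℕ) : ℤ)
    simp only [Int.cast_natCast] at this
    rw [← this]
    simp
  have hS0 : S.card ≠ 0 := hS.card_pos.ne'
  have hSN : S.card ≤ N := by simpa [ZMod.card] using Finset.card_le_univ S
  set a := N.factorization p with ha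
  set J := (Finset.Icc 1 a).filter fun j => ∃ s ∈ S, ∃ s' ∈ S, addOrderOf (s - s') = p ^ j with hJ
  have hdv : p ^ J.card ∣ S.card := by
    rw [← hcard]
    apply aux_dvd N Λ p hp J
    intro j hj
    rw [hJ, Finset.mem_filter, Finset.mem_Icc] at hj
    obtain ⟨⟨hj1, hj2⟩, s, hs, s', hs', ho⟩ := hj
    refine ⟨hj1, s - s', ho, aux_dual N S Λ hS hcard horth' s s' hs hs' ?_⟩
    rintro rfl
    rw [sub_self, addOrderOf_zero] at ho
    exact absurd ho.symm (Nat.one_lt_pow (by omega) hp.one_lt).ne'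
  have hJa : J.card ≤ a := by
    simpa using Finset.card_filter_le (Finset.Icc 1 a)
      (fun j => ∃ s ∈ S, ∃ s' ∈ S, addOrderOf (s - s') = p ^ j)
  have hJN : p ^ J.card ∣ Nat.gcd N S.card :=
    Nat.dvd_gcd ((pow_dvd_pow p hJa).trans (Nat.ordProj_dvd N p)) hdv
  have hkJ : k + J.card ≤ a := by
    rw [ha, ← hp.pow_dvd_iff_le_factorization (by omega), pow_add]
    conv_rhs => rw [hNk]
    exact mul_dvd_mul_left _ hJN
  obtain ⟨T, hT, hTd⟩ := aux_T N p hp (Finset.Icc 1 a \ J) (by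
    intro i hi
    rw [Finset.mem_sdiff, Finset.mem_Icc] at hi
    exact ⟨hi.1.1, (pow_dvd_pow p hi.1.2).trans (Nat.ordProj_dvd N p)⟩)
  have hTk : p ^ k ≤ T.card := by
    have hsub : J ⊆ Finset.Icc 1 a := Finset.filter_subset _ _
    rw [hT, Finset.card_sdiff_of_subset hsub, Nat.card_Icc]
    exact Nat.pow_le_pow_right hp.pos (by omega)
  have hinj : Set.InjOn (fun q : ZMod N × ZMod N => q.1 + q.2) (S ×ˢ T : Finset _) := by
    rintro ⟨s, t⟩ h1 ⟨s', t'⟩ h2 h3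
    simp only [Finset.coe_product, Set.mem_prod, Finset.mem_coe] at h1 h2
    simp only at h3
    by_cases htt : t' = t
    · subst htt
      simpa using h3
    · exfalso
      obtain ⟨i, hi, ho⟩ := hTd t' h2.2 t h1.2 htt
      rw [Finset.mem_sdiff] at hi
      apply hi.2
      rw [hJ, Finset.mem_filter]
      refine ⟨hi.1, s, h1.1, s', h2.1, ?_⟩
      rw [← ho]
      congr 1
      linear_combination h3
  have himg : (S ×ˢ T).image (fun q : ZMod N × ZMod N => q.1 + q.2) = Finset.univ := by
    apply Finset.eq_univ_of_card
    apply le_antisymm (Finset.card_le_univ _)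
    rw [Finset.card_image_of_injOn hinj, Finset.card_product, ZMod.card]
    calc N = Nat.gcd N S.card * p ^ k := by rw [mul_comm]; exact hNk
      _ ≤ S.card * T.card :=
        Nat.mul_le_mul (Nat.le_of_dvd hS.card_pos (Nat.gcd_dvd_right _ _)) hTk
  refine ⟨T, fun g => ?_⟩
  have hg : g ∈ (S ×ˢ T).image (fun q : ZMod N × ZMod N => q.1 + q.2) := by
    rw [himg]; exact Finset.mem_univ g
  obtain ⟨q, hq, hqg⟩ := Finset.mem_image.1 hg
  refine ⟨q, ⟨(Finset.mem_product.1 hq).1, (Finset.mem_product.1 hq).2, hqg⟩, ?_⟩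
  rintro q' ⟨h1, h2, h3⟩
  exact hinj (Finset.mem_coe.2 (Finset.mem_product.2 ⟨h1, h2⟩)) hq (h3.trans hqg.symm)
end

section
/- Let p, q, r be distinct primes and let (S, Λ) be a spectral pair in ℤ_{p^2 q^2 r}. If gcd(|S|, p^2 q^2 r) = p^2 r, then |S| = p^2 r and S tiles ℤ_{p^2 q^2 r}. -/
/-- The character sum of a spectral pair, written with the standard additive character. -/
theorem SpectralPair.char_sum {n : ℕ} [NeZero n] {S Λ : Finset (ZMod n)}
    (h : SpectralPair n S Λ) {lam mu : ZMod n} (hl : lam ∈ Λ) (hm : mu ∈ Λ) (hne : lam ≠ mu) :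
    ∑ s ∈ S, ZMod.stdAddChar ((lam - mu) * s) = 0 := by
  rw [← h.2 lam hl mu hm hne]
  refine Finset.sum_congr rfl fun s _ => ?_
  have := ZMod.stdAddChar_coe (N := n) (((lam - mu).val * s.val : ℕ) : ℤ)
  rw [Int.cast_natCast, Int.cast_natCast, Nat.cast_mul, ZMod.natCast_zmod_val,
    ZMod.natCast_zmod_val] at this
  exact this

/-- Duality of spectral pairs: a square matrix with orthogonal rows has orthogonal columns. -/
theorem SpectralPair.dual_sum {n : ℕ} [NeZero n] {S Λ : Finset (ZMod n)}
    (h : SpectralPair n S Λ) {s t : ZMod n} (hs : s ∈ S) (ht : t ∈ S) (hne : s ≠ t) :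
    ∑ l ∈ Λ, ZMod.stdAddChar ((s - t) * l) = 0 := by
  classical
  have hm : (S.card : ℂ) ≠ 0 := by
    exact_mod_cast (Finset.card_pos.mpr ⟨s, hs⟩).ne'
  let A : Matrix Λ S ℂ := fun l x => ZMod.stdAddChar (l.1 * x.1)
  let B : Matrix S Λ ℂ := fun x l => (S.card : ℂ)⁻¹ * ZMod.stdAddChar (-(l.1 * x.1))
  have hAB : A * B = 1 := by
    ext l k
    have e : (A * B) l k =
        (S.card : ℂ)⁻¹ * ∑ x ∈ S, ZMod.stdAddChar ((l.1 - k.1) * x) := by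
      rw [Matrix.mul_apply, ← Finset.sum_coe_sort S, Finset.mul_sum]
      refine Finset.sum_congr rfl fun x _ => ?_
      simp only [A, B]
      rw [mul_left_comm, ← AddChar.map_add_eq_mul]
      congr 2
      ring
    rw [e]
    by_cases hlk : l = k
    · subst hlk
      simp [hm]
    · rw [h.char_sum l.2 k.2 (fun hh => hlk (Subtype.ext hh)), Matrix.one_apply_ne hlk, mul_zero]
  have hcard : Fintype.card Λ = Fintype.card S := by simpa using h.1
  have hBA : B * A = 1 := (Matrix.mul_eq_one_comm_of_card_eq _ _ _ hcard).mp hAB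
  have h0 : (B * A) ⟨t, ht⟩ ⟨s, hs⟩ = 0 := by
    rw [hBA, Matrix.one_apply_ne]
    intro hh
    exact hne (congrArg Subtype.val hh).symm
  have e : (B * A) ⟨t, ht⟩ ⟨s, hs⟩ =
      (S.card : ℂ)⁻¹ * ∑ l ∈ Λ, ZMod.stdAddChar ((s - t) * l) := by
    rw [Matrix.mul_apply, ← Finset.sum_coe_sort Λ, Finset.mul_sum]
    refine Finset.sum_congr rfl fun x _ => ?_
    simp only [A, B]
    rw [mul_assoc, ← AddChar.map_add_eq_mul]
    congr 2
    ring
  rw [e] at h0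
  exact (mul_eq_zero.mp h0).resolve_left (inv_ne_zero hm)

/-- If a character sum of prime power order over `L` vanishes, the prime divides `|L|`. -/
theorem prime_dvd_card_of_sum_eq_zero {n : ℕ} [NeZero n] {q k : ℕ} (hq : q.Prime)
    (L : Finset (ZMod n)) (d : ZMod n) (hd : d ≠ 0) (hqd : ((q ^ k : ℕ) : ZMod n) * d = 0)
    (hsum : ∑ l ∈ L, ZMod.stdAddChar (d * l) = 0) : q ∣ L.card := by
  set w : ℂ := ZMod.stdAddChar d with hw
  have hw1 : w ≠ 1 := by
    intro hh
    apply hd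
    apply ZMod.injective_stdAddChar (N := n)
    rw [← hw, hh, AddChar.map_zero_eq_one]
  have hwq : w ^ (q ^ k) = 1 := by
    rw [hw, ← AddChar.map_nsmul_eq_pow, nsmul_eq_mul, hqd, AddChar.map_zero_eq_one]
  obtain ⟨j, -, hj⟩ := (Nat.dvd_prime_pow hq).mp (orderOf_dvd_of_pow_eq_one hwq)
  have hprim : IsPrimitiveRoot w (q ^ j) := hj ▸ IsPrimitiveRoot.orderOf w
  obtain _ | i := j
  · rw [pow_zero, orderOf_eq_one_iff] at hj
    exact absurd hj hw1
  let P : Polynomial ℤ := ∑ l ∈ L, Polynomial.X ^ l.val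
  have hP : Polynomial.aeval w P = 0 := by
    rw [← hsum]
    simp only [P, map_sum, map_pow, Polynomial.aeval_X]
    refine Finset.sum_congr rfl fun l _ => ?_
    rw [hw, ← AddChar.map_nsmul_eq_pow, nsmul_eq_mul, ZMod.natCast_zmod_val, mul_comm]
  have hpos : 0 < q ^ (i + 1) := pow_pos hq.pos _
  have hdvd : Polynomial.cyclotomic (q ^ (i + 1)) ℤ ∣ P := by
    rw [Polynomial.cyclotomic_eq_minpoly hprim hpos]
    exact minpoly.isIntegrallyClosed_dvd (hprim.isIntegral hpos) hP
  have hev := Polynomial.eval_dvd (x := (1 : ℤ)) hdvd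
  have := Fact.mk hq
  rw [Polynomial.eval_one_cyclotomic_prime_pow] at hev
  simp only [P, Polynomial.eval_finsetSum, Polynomial.eval_pow, Polynomial.eval_X, one_pow,
    Finset.sum_const, nsmul_eq_mul, mul_one] at hev
  exact_mod_cast hev

theorem p2r_case_tiles
    (p q r : ℕ) (hp : p.Prime) (hq : q.Prime) (hr : r.Prime)
    (hpq : p ≠ q) (hpr : p ≠ r) (hqr : q ≠ r)
    (S Λ : Finset (ZMod (p ^ 2 * q ^ 2 * r)))
    (h : SpectralPair (p ^ 2 * q ^ 2 * r) S Λ)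
    (hgcd : Nat.gcd S.card (p ^ 2 * q ^ 2 * r) = p ^ 2 * r) :
    S.card = p ^ 2 * r ∧ IsTile (p ^ 2 * q ^ 2 * r) S := by
  have hn : p ^ 2 * q ^ 2 * r ≠ 0 :=
    mul_ne_zero (mul_ne_zero (pow_ne_zero _ hp.ne_zero) (pow_ne_zero _ hq.ne_zero)) hr.ne_zero
  have hM : p ^ 2 * r ≠ 0 := mul_ne_zero (pow_ne_zero _ hp.ne_zero) hr.ne_zero
  have hMn : p ^ 2 * r ∣ p ^ 2 * q ^ 2 * r := ⟨q ^ 2, by ring⟩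
  have hqS : ¬ q ∣ S.card := by
    intro hh
    have h1 : q ∣ p ^ 2 * r := by
      rw [← hgcd]
      exact Nat.dvd_gcd hh ⟨p ^ 2 * q * r, by ring⟩
    rcases hq.dvd_mul.mp h1 with h2 | h2
    · exact hpq ((Nat.prime_dvd_prime_iff_eq hq hp).mp (hq.dvd_of_dvd_pow h2)).symm
    · exact hqr ((Nat.prime_dvd_prime_iff_eq hq hr).mp h2)
  have hMS : p ^ 2 * r ∣ S.card := hgcd ▸ Nat.gcd_dvd_left _ _
  generalize hMdef : p ^ 2 * r = M at *
  have hnM : p ^ 2 * q ^ 2 * r = q ^ 2 * M := by rw [← hMdef]; ring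
  generalize p ^ 2 * q ^ 2 * r = n at *
  have : NeZero n := ⟨hn⟩
  have : NeZero M := ⟨hM⟩
  let f := ZMod.castHom hMn (ZMod M)
  have hinj : Set.InjOn f S := by
    intro s hs t ht hst
    by_contra hne
    have hf : f (s - t) = 0 := by rw [map_sub, hst, sub_self]
    have hdv : M ∣ (s - t).val := by
      rw [← ZMod.natCast_eq_zero_iff, ← hf, ← map_natCast f, ZMod.natCast_zmod_val]
    have hqd : ((q ^ 2 : ℕ) : ZMod n) * (s - t) = 0 := by
      rw [← ZMod.natCast_zmod_val (s - t), ← Nat.cast_mul, ZMod.natCast_eq_zero_iff]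
      exact hnM.dvd.trans (mul_dvd_mul_left _ hdv)
    have := prime_dvd_card_of_sum_eq_zero hq Λ (s - t) (sub_ne_zero.mpr hne) hqd
      (h.dual_sum hs ht hne)
    exact hqS (h.1 ▸ this)
  have hci : (S.image f).card = S.card := Finset.card_image_of_injOn hinj
  have hle : S.card ≤ M := by
    rw [← hci]
    exact (Finset.card_le_univ _).trans (ZMod.card M).le
  have hS : S.card = M := by
    refine le_antisymm hle (Nat.le_of_dvd (Nat.pos_of_ne_zero fun h0 => hqS ?_) hMS)
    rw [h0]
    exact dvd_zero q
  refine ⟨hS, Finset.univ.filter (fun t => f t = 0), fun g => ?_⟩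
  have himg : S.image f = Finset.univ := by
    rw [← Finset.card_eq_iff_eq_univ, hci, hS, ZMod.card]
  obtain ⟨s, hs, hsg⟩ := Finset.mem_image.mp (himg ▸ Finset.mem_univ (f g) : f g ∈ S.image f)
  refine ⟨(s, g - s), ⟨hs, ?_, add_sub_cancel s g⟩, ?_⟩
  · simp [hsg]
  · rintro ⟨a, b⟩ ⟨ha, hb, hab⟩
    simp only [Finset.mem_filter, Finset.mem_univ, true_and] at hb
    simp only at ha hab
    have has : a = s := by
      apply hinj ha hs
      rw [hsg, ← hab, map_add, hb, add_zero]
    subst has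
    rw [← hab, add_sub_cancel_left]
end
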